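/- Let k be a field of characteristic 0, m ≥ 3 an integer, and n, p ≥ 0. Let φ be the natural inclusion k[x₁^{±1},…,xₙ^{±1}][y₁,…,y_p] → k(x₁,…,xₙ)[y₁,…,y_p] (sending each x_i to itself viewed in the rational function field and each y_j to y_j). If g ∈ SL_m(k[x₁^{±1},…,xₙ^{±1}][y₁,…,y_p]) is such that φ(g) ∈ E_m(k(x₁,…,xₙ)[y₁,…,y_p]), then g ∈ E_m(k[x₁^{±1},…,xₙ^{±1}][y₁,…,y_p]). In particular, taking p = 0, the natural map K1^{SL_m}(k[x₁^{±1},…,xₙ^{±1}]) → K1^{SL_m}(k(x₁,…,xₙ)) is injective. -/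

import Mathlib

open Matrix

/-- The elementary subgroup `E_m(S)` of `SL_m(S)`. -/
def ElemSubgroup (m : ℕ) (S : Type*) [CommRing S] :
    Subgroup (SpecialLinearGroup (Fin m) S) :=
  Subgroup.closure { g | ∃ i j : Fin m, ∃ a : S, i ≠ j ∧
    (g : Matrix (Fin m) (Fin m) S) = Matrix.transvection i j a }

namespace ElemSubgroup

section Basic

variable {m : ℕ} {R S T : Type*} [CommRing R] [CommRing S] [CommRing T]

theorem transvection_mem {i j : Fin m} (hij : i ≠ j) (a : R) :
    SpecialLinearGroup.transvection hij a ∈ ElemSubgroup m R :=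
  Subgroup.subset_closure ⟨i, j, a, hij, rfl⟩

theorem le_of_transvection_mem {H : Subgroup (SpecialLinearGroup (Fin m) R)}
    (h : ∀ (i j : Fin m) (hij : i ≠ j) (a : R), SpecialLinearGroup.transvection hij a ∈ H) :
    ElemSubgroup m R ≤ H := by
  refine (Subgroup.closure_le _).2 ?_
  rintro g ⟨i, j, a, hij, hg⟩
  have : g = SpecialLinearGroup.transvection hij a := Subtype.ext hg
  exact this ▸ h i j hij a

theorem map_transvection (f : R →+* S) {i j : Fin m} (hij : i ≠ j) (a : R) :
    SpecialLinearGroup.map f (SpecialLinearGroup.transvection hij a) =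
      SpecialLinearGroup.transvection hij (f a) := by
  ext p q
  simp [Matrix.SpecialLinearGroup.transvection_coe, Matrix.one_apply, Matrix.single_apply,
    apply_ite f]

theorem map_mem (f : R →+* S) {g : SpecialLinearGroup (Fin m) R} (hg : g ∈ ElemSubgroup m R) :
    SpecialLinearGroup.map f g ∈ ElemSubgroup m S := by
  have : ElemSubgroup m R ≤ (ElemSubgroup m S).comap (SpecialLinearGroup.map f) :=
    le_of_transvection_mem fun i j hij a => by
      rw [Subgroup.mem_comap, map_transvection]
      exact transvection_mem hij _
  exact this hg

/-- Induction on elementary matrices, multiplying by a transvection on the right. -/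
theorem induction_right {C : SpecialLinearGroup (Fin m) R → Prop} (one : C 1)
    (mul : ∀ g, g ∈ ElemSubgroup m R → ∀ (i j : Fin m) (hij : i ≠ j) (a : R), C g →
      C (g * SpecialLinearGroup.transvection hij a))
    {g : SpecialLinearGroup (Fin m) R} (hg : g ∈ ElemSubgroup m R) : C g := by
  have key : ∀ g : SpecialLinearGroup (Fin m) R, ∀ i j a, i ≠ j →
      (g : Matrix (Fin m) (Fin m) R) = Matrix.transvection i j a →
      ∃ hij : i ≠ j, g = SpecialLinearGroup.transvection hij a :=
    fun g i j a hij h => ⟨hij, Subtype.ext h⟩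
  refine Subgroup.closure_induction_right (p := fun g _ => C g) one ?_ ?_ hg
  · rintro x hx y ⟨i, j, a, hij, h⟩ hC
    obtain ⟨hij, rfl⟩ := key _ _ _ _ hij h
    exact mul x hx i j hij a hC
  · rintro x hx y ⟨i, j, a, hij, h⟩ hC
    obtain ⟨hij, rfl⟩ := key _ _ _ _ hij h
    rw [SpecialLinearGroup.transvection_inv]
    exact mul x hx i j hij _ hC

/-- Induction on elementary matrices, multiplying by a transvection on the left. -/
theorem induction_left {C : SpecialLinearGroup (Fin m) R → Prop} (one : C 1)
    (mul : ∀ g, g ∈ ElemSubgroup m R → ∀ (i j : Fin m) (hij : i ≠ j) (a : R), C g →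
      C (SpecialLinearGroup.transvection hij a * g))
    {g : SpecialLinearGroup (Fin m) R} (hg : g ∈ ElemSubgroup m R) : C g := by
  have := induction_right (C := fun g => C g⁻¹) (by simpa using one)
    (fun g hg i j hij a h => by
      rw [_root_.mul_inv_rev, SpecialLinearGroup.transvection_inv]
      exact mul _ (inv_mem hg) i j hij _ h) (inv_mem hg)
  simpa using this

theorem map_map (f : R →+* S) (f' : S →+* T) (g : SpecialLinearGroup (Fin m) R) :
    SpecialLinearGroup.map f' (SpecialLinearGroup.map f g) =
      SpecialLinearGroup.map (f'.comp f) g := by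
  ext; simp

theorem map_id (g : SpecialLinearGroup (Fin m) R) :
    SpecialLinearGroup.map (RingHom.id R) g = g := by
  ext; simp

theorem map_injective {f : R →+* S} (hf : Function.Injective f) :
    Function.Injective (SpecialLinearGroup.map (n := Fin m) f) := by
  intro g h hgh
  ext i j
  have := congrArg (fun x : SpecialLinearGroup (Fin m) S => x i j) hgh
  exact hf (by simpa using this)

/-- The matrices underlying the image of `E_m(R)` in `SL_m(S)`. -/
def matrixImage (m : ℕ) (f : R →+* S) : Submonoid (Matrix (Fin m) (Fin m) S) :=
  (ElemSubgroup m R).toSubmonoid.map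
    (((Units.coeHom _).comp SpecialLinearGroup.toGL).comp (SpecialLinearGroup.map f))

theorem mem_matrixImage {f : R →+* S} {A : Matrix (Fin m) (Fin m) S} :
    A ∈ matrixImage m f ↔
      ∃ e ∈ ElemSubgroup m R, (SpecialLinearGroup.map f e : Matrix (Fin m) (Fin m) S) = A :=
  Iff.rfl

theorem coe_mem_matrixImage {f : R →+* S} {g : SpecialLinearGroup (Fin m) S} :
    (g : Matrix (Fin m) (Fin m) S) ∈ matrixImage m f ↔
      g ∈ (ElemSubgroup m R).map (SpecialLinearGroup.map f) := by
  rw [mem_matrixImage, Subgroup.mem_map]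
  exact exists_congr fun e => and_congr_right fun _ => Subtype.ext_iff.symm

theorem transvection_mem_matrixImage (f : R →+* S) {i j : Fin m} (hij : i ≠ j) {a : S} (b : R)
    (h : f b = a) :
    Matrix.transvection i j a ∈ matrixImage m f :=
  ⟨_, transvection_mem hij b, by
    subst h
    exact congrArg Subtype.val (map_transvection f hij b)⟩

theorem one_add_sum_mem {A ι : Type*} [Ring A] (M : Submonoid A) (s : Finset ι) (N : ι → A)
    (h0 : ∀ a ∈ s, ∀ b ∈ s, N a * N b = 0) (h : ∀ a ∈ s, 1 + N a ∈ M) :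
    1 + ∑ a ∈ s, N a ∈ M := by
  classical
  induction s using Finset.induction_on with
  | empty => simp
  | insert a s has ih =>
    rw [Finset.sum_insert has]
    have : 1 + (N a + ∑ b ∈ s, N b) = (1 + N a) * (1 + ∑ b ∈ s, N b) := by
      have h1 : N a * ∑ b ∈ s, N b = 0 := by
        rw [Finset.mul_sum]
        exact Finset.sum_eq_zero fun b hb =>
          h0 a (Finset.mem_insert_self _ _) b (Finset.mem_insert_of_mem hb)
      rw [mul_add, add_mul, add_mul, h1]
      simp [add_assoc]
    rw [this]
    exact mul_mem (h a (Finset.mem_insert_self _ _))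
      (ih (fun a ha b hb => h0 a (Finset.mem_insert_of_mem ha) b (Finset.mem_insert_of_mem hb))
        fun a ha => h a (Finset.mem_insert_of_mem ha))

/-- The rank one matrix `a (b e_p + c e_q) (b e_q - c e_p)ᵀ`, whose square is zero. -/
def koszulBlock (p q : Fin m) (a b c : R) : Matrix (Fin m) (Fin m) R :=
  a • vecMulVec (Pi.single p b + Pi.single q c) (Pi.single q b - Pi.single p c)

theorem commutator_eq_one_add {A : Type*} [Ring A] {x y : A} (hx : x * x = 0) (hy : y * y = 0)
    (hyx : y * x = 0) : (1 + x) * (1 + y) * (1 - x) * (1 - y) = 1 + x * y := by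
  have h1 : (1 + y) * (1 - x) = 1 - x + y := by
    simp only [mul_sub, add_mul, mul_one, one_mul, hyx]; abel
  have h2 : (1 - x + y) * (1 - y) = 1 - x + x * y := by
    simp only [mul_sub, add_mul, sub_mul, mul_one, one_mul, hy]; abel
  have h3 : (1 + x) * (1 - x + x * y) = 1 + x * y := by
    simp only [mul_sub, mul_add, add_mul, mul_one, one_mul, ← mul_assoc, hx, zero_mul]; abel
  rw [mul_assoc (1 + x), h1, mul_assoc, h2, h3]

theorem one_add_koszulBlock_mem (f : R →+* S) {p q r : Fin m} (hpq : p ≠ q) (hrp : r ≠ p)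
    (hrq : r ≠ q) (a b c : R) {a' b' c' : S} (ha : f a = a') (hb : f b = b') (hc : f c = c') :
    1 + koszulBlock p q a' b' c' ∈ matrixImage m f := by
  subst ha hb hc
  have e : ∀ (p q : Fin m) (x y : S),
      vecMulVec (Pi.single p x) (Pi.single q y) = single p q (x * y) := by
    intro p q x y
    ext i j
    simp only [vecMulVec_apply, Pi.single_apply, single_apply, eq_comm (a := p), eq_comm (a := q)]
    split_ifs <;> simp_all
  set x : Matrix (Fin m) (Fin m) S := single p r (f b) + single q r (f c)
  set y : Matrix (Fin m) (Fin m) S := single r q (f (a * b)) + single r p (f (-(a * c)))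
  have hxy : koszulBlock p q (f a) (f b) (f c) = x * y := by
    simp only [x, y, koszulBlock, add_vecMulVec, vecMulVec_sub, e, mul_add, add_mul,
      single_mul_single_same, map_neg, map_mul]
    ext i j
    simp only [Matrix.add_apply, Matrix.smul_apply, Matrix.sub_apply, single_apply, smul_eq_mul]
    split_ifs <;> ring
  have hx : x * x = 0 := by
    simp [x, mul_add, add_mul, single_mul_single_of_ne _ _ _ _ hrp,
      single_mul_single_of_ne _ _ _ _ hrq]
  have hy : y * y = 0 := by
    simp [y, mul_add, add_mul, single_mul_single_of_ne _ _ _ _ hrp.symm,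
      single_mul_single_of_ne _ _ _ _ hrq.symm]
  have hyx : y * x = 0 := by
    simp [x, y, mul_add, add_mul, single_mul_single_of_ne _ _ _ _ hpq,
      single_mul_single_of_ne _ _ _ _ hpq.symm]
    rw [← single_add]
    convert single_zero r r using 2
    ring
  have hx1 : ∀ b c, 1 + (single p r (f b) + single q r (f c)) ∈ matrixImage m f := by
    intro b c
    have : 1 + (single p r (f b) + single q r (f c)) =
        transvection p r (f b) * transvection q r (f c) := by
      simp [transvection, mul_add, add_mul, single_mul_single_of_ne _ _ _ _ hrq, add_assoc]
    rw [this]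
    exact mul_mem (transvection_mem_matrixImage f hrp.symm _ rfl)
      (transvection_mem_matrixImage f hrq.symm _ rfl)
  have hy1 : ∀ b c, 1 + (single r q (f b) + single r p (f c)) ∈ matrixImage m f := by
    intro b c
    have : 1 + (single r q (f b) + single r p (f c)) =
        transvection r q (f b) * transvection r p (f c) := by
      simp [transvection, mul_add, add_mul, single_mul_single_of_ne _ _ _ _ hrq.symm, add_assoc]
    rw [this]
    exact mul_mem (transvection_mem_matrixImage f hrq _ rfl)
      (transvection_mem_matrixImage f hrp _ rfl)
  have hsub : ∀ (i j i' j' : Fin m) (b c : R), 1 - (single i j (f b) + single i' j' (f c)) =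
      1 + (single i j (f (-b)) + single i' j' (f (-c))) := by
    intro i j i' j' b c
    rw [sub_eq_add_neg, neg_add, map_neg, map_neg, single_neg, single_neg]
  rw [hxy, ← commutator_eq_one_add hx hy hyx]
  refine mul_mem (mul_mem (mul_mem (hx1 _ _) (hy1 _ _)) ?_) ?_
  · simpa only [x, hsub] using hx1 _ _
  · simpa only [y, hsub] using hy1 _ _

theorem vecMulVec_mul_vecMulVec_eq_zero {u v w x : Fin m → R} (h : v ⬝ᵥ w = 0) :
    vecMulVec u v * vecMulVec w x = 0 := by
  rw [vecMulVec_mul_vecMulVec, h, zero_smul, vecMulVec_zero]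

/-- The elementary row vector `v_p e_q - v_q e_p`, orthogonal to `v`. -/
def koszulRow (v : Fin m → R) (p q : Fin m) : Fin m → R :=
  Pi.single q (v p) - Pi.single p (v q)

theorem koszulRow_dotProduct (v w : Fin m → R) (p q : Fin m) :
    koszulRow v p q ⬝ᵥ w = v p * w q - v q * w p := by
  simp [koszulRow, sub_dotProduct]

/-- A monoid of matrices contains `1 + a v (v_p e_q - v_q e_p)ᵀ` as soon as it contains
the obvious transvections and the Koszul block. -/
theorem one_add_koszul_mem (M : Submonoid (Matrix (Fin m) (Fin m) R)) {p q : Fin m} (hpq : p ≠ q)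
    (a : R) (v : Fin m → R)
    (h1 : ∀ r, r ≠ p → r ≠ q → transvection r q (a * v r * v p) ∈ M)
    (h2 : ∀ r, r ≠ p → r ≠ q → transvection r p (-(a * v r * v q)) ∈ M)
    (h3 : 1 + koszulBlock p q a (v p) (v q) ∈ M) :
    1 + a • vecMulVec v (koszulRow v p q) ∈ M := by
  set u : Fin m → Fin m → R := fun r =>
    if r = p then Pi.single p (v p) + Pi.single q (v q) else if r = q then 0 else Pi.single r (v r)
  have hu : v = ∑ r, u r := by
    ext s
    have h : ∀ r, u r s = (if r = s then v s else 0) +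
        ((if r = p then (if s = q then v q else 0) else 0) -
          (if r = q then (if s = q then v q else 0) else 0)) := by
      intro r
      simp only [u]
      by_cases hp : r = p
      · subst hp
        simp only [if_true, Pi.add_apply, Pi.single_apply, if_neg hpq, sub_zero]
        by_cases hs : s = r
        · subst hs; simp [hpq]
        · simp [hs, Ne.symm hs]
      · by_cases hq : r = q
        · subst hq
          by_cases hs : s = r
          · subst hs; simp [hp]
          · simp [hs, hp, Ne.symm hs]
        · by_cases hs : s = r
          · subst hs; simp [hp, hq]
          · simp [hs, hp, hq, Ne.symm hs]
    rw [Finset.sum_apply, Finset.sum_congr rfl fun r _ => h r, Finset.sum_add_distrib,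
      Finset.sum_sub_distrib]
    simp
  have hsum : a • vecMulVec v (koszulRow v p q) =
      ∑ r, a • vecMulVec (u r) (koszulRow v p q) := by
    ext i j
    have hi : v i = ∑ r, u r i := by rw [← Finset.sum_apply, ← hu]
    simp only [Matrix.sum_apply, Matrix.smul_apply, vecMulVec_apply, smul_eq_mul]
    rw [hi, Finset.sum_mul, Finset.mul_sum]
  rw [hsum]
  refine one_add_sum_mem M _ _ ?_ ?_
  · intro r _ s _
    rw [Matrix.smul_mul, Matrix.mul_smul, vecMulVec_mul_vecMulVec_eq_zero, smul_zero, smul_zero]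
    rw [koszulRow_dotProduct]
    simp only [u]
    split_ifs with hp hq
    · simp [hpq, hpq.symm]; ring
    · simp
    · simp [Ne.symm hp, Ne.symm hq]
  · intro r _
    simp only [u]
    split_ifs with hp hq
    · exact h3
    · simp
    · have : 1 + a • vecMulVec (Pi.single r (v r)) (koszulRow v p q) =
          transvection r q (a * v r * v p) * transvection r p (-(a * v r * v q)) := by
        simp only [transvection, mul_add, add_mul, mul_one, one_mul,
          single_mul_single_of_ne _ _ _ _ (Ne.symm hq), add_zero, add_assoc]
        congr 1
        ext i j
        simp only [koszulRow, Matrix.smul_apply, vecMulVec_apply, Matrix.add_apply, single_apply,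
          Pi.single_apply, Pi.sub_apply, smul_eq_mul, eq_comm (a := r), eq_comm (b := p),
          eq_comm (a := q)]
        split_ifs <;> simp_all <;> ring
      rw [this]
      exact mul_mem (h1 r hp hq) (h2 r hp hq)

/-- A conjugate of a transvection lies in every monoid of matrices containing suitable
transvections and Koszul blocks. -/
theorem conj_transvection_mem (M : Submonoid (Matrix (Fin m) (Fin m) R))
    (γ : SpecialLinearGroup (Fin m) R) {i j : Fin m} (hij : i ≠ j) (z : R) (P : R → Prop)
    (hγ : ∀ i j, P (γ i j)) (hγ' : ∀ i j, P (γ⁻¹ i j))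
    (h1 : ∀ r q, r ≠ q → ∀ a b c d, P a → P b → P c → P d →
      transvection r q (z * a * b * c * d) ∈ M)
    (h2 : ∀ r q, r ≠ q → ∀ a b c d, P a → P b → P c → P d →
      transvection r q (-(z * a * b * c * d)) ∈ M)
    (h3 : ∀ p q, p ≠ q → ∀ a b c d, P a → P b → P c → P d →
      1 + koszulBlock p q (z * a * b) c d ∈ M) :
    (↑(γ * SpecialLinearGroup.transvection hij z * γ⁻¹) : Matrix (Fin m) (Fin m) R) ∈ M := by
  set v : Fin m → R := fun p => γ p i
  set φ : Fin m → R := fun q => γ⁻¹ j q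
  set ψ : Fin m → R := fun q => γ⁻¹ i q
  have hinv : ∀ s, ∑ p, γ⁻¹ s p * γ p i = (1 : Matrix (Fin m) (Fin m) R) s i := by
    intro s
    have := congrArg (fun x : SpecialLinearGroup (Fin m) R => x s i) (inv_mul_cancel γ)
    rwa [Matrix.SpecialLinearGroup.coe_mul, Matrix.SpecialLinearGroup.coe_one,
      Matrix.mul_apply] at this
  have hψ : ∑ p, ψ p * v p = 1 := (hinv i).trans (Matrix.one_apply_eq i)
  have hφ : ∑ p, φ p * v p = 0 := (hinv j).trans (Matrix.one_apply_ne hij.symm)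
  have hinv' : (γ : Matrix (Fin m) (Fin m) R) * (γ⁻¹ : SpecialLinearGroup (Fin m) R) = 1 := by
    rw [← Matrix.SpecialLinearGroup.coe_mul, mul_inv_cancel, Matrix.SpecialLinearGroup.coe_one]
  have hE : (↑(γ * SpecialLinearGroup.transvection hij z * γ⁻¹) : Matrix (Fin m) (Fin m) R) =
      1 + ∑ x : Fin m × Fin m, (z * φ x.2 * ψ x.1) • vecMulVec v (koszulRow v x.1 x.2) := by
    rw [Matrix.SpecialLinearGroup.coe_mul, Matrix.SpecialLinearGroup.coe_mul,
      Matrix.SpecialLinearGroup.transvection_coe, mul_add, add_mul, mul_one, hinv']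
    congr 1
    ext r s
    have hL : ((γ : Matrix (Fin m) (Fin m) R) * single i j z *
        (γ⁻¹ : SpecialLinearGroup (Fin m) R)) r s = z * (v r * φ s) := by
      rw [Matrix.mul_apply, Finset.sum_eq_single j]
      · simp [v, φ]; ring
      · intro b _ hb
        rw [Matrix.mul_single_apply_of_ne _ _ _ _ _ hb, zero_mul]
      · simp
    rw [hL, Fintype.sum_prod_type]
    simp only [Matrix.sum_apply, Matrix.smul_apply, vecMulVec_apply, smul_eq_mul, koszulRow,
      Pi.sub_apply, Pi.single_apply]
    have h1 : ∀ p q, z * φ q * ψ p * (v r * ((if s = q then v p else 0) -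
        if s = p then v q else 0)) = (if s = q then z * v r * φ q * (ψ p * v p) else 0) -
        if s = p then z * v r * ψ p * (φ q * v q) else 0 := by
      intro p q
      split_ifs <;> ring
    have hA : ∀ p, ∑ q, (if s = q then z * v r * φ q * (ψ p * v p) else 0) =
        z * v r * φ s * (ψ p * v p) := fun p => by simp
    have hB : ∀ p, ∑ q, (if s = p then z * v r * ψ p * (φ q * v q) else 0) = 0 := by
      intro p
      split_ifs
      · rw [← Finset.mul_sum, hφ, mul_zero]
      · simp
    simp only [h1, Finset.sum_sub_distrib, hA, hB, ← Finset.mul_sum, hψ, Finset.sum_const_zero]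
    ring
  rw [hE]
  refine one_add_sum_mem M _ _ ?_ ?_
  · intro x _ y _
    rw [Matrix.smul_mul, Matrix.mul_smul, vecMulVec_mul_vecMulVec_eq_zero, smul_zero, smul_zero]
    rw [koszulRow_dotProduct, mul_comm, sub_self]
  · rintro ⟨p, q⟩ _
    by_cases hpq : p = q
    · subst hpq
      have : koszulRow v p p = 0 := sub_self _
      simp [this]
    · refine one_add_koszul_mem M hpq _ _ ?_ ?_ ?_
      · intro r _ hrq
        exact h1 r q hrq _ _ _ _ (hγ' _ _) (hγ' _ _) (hγ _ _) (hγ _ _)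
      · intro r hrp _
        exact h2 r p hrp _ _ _ _ (hγ' _ _) (hγ' _ _) (hγ _ _) (hγ _ _)
      · exact h3 p q hpq _ _ _ _ (hγ' _ _) (hγ' _ _) (hγ _ _) (hγ _ _)

theorem exists_ne_ne (hm : 3 ≤ m) (p q : Fin m) : ∃ r, r ≠ p ∧ r ≠ q := by
  have : ({p, q} : Finset (Fin m)).card < (Finset.univ : Finset (Fin m)).card :=
    (Finset.card_le_two).trans_lt (by simpa [Nat.lt_iff_add_one_le] using hm)
  obtain ⟨r, _, hr⟩ := Finset.exists_mem_notMem_of_card_lt_card this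
  exact ⟨r, by simpa using hr⟩

theorem exists_common_denom (M : Submonoid R) [Algebra R T] [IsLocalization M T] {ι : Type*}
    [Finite ι] (f : ι → T) :
    ∃ d ∈ M, ∀ i, ∃ a, algebraMap R T d * f i = algebraMap R T a := by
  cases nonempty_fintype ι
  obtain ⟨d, hd⟩ := IsLocalization.exist_integer_multiples_of_finite M f
  exact ⟨d, d.2, fun i => by
    obtain ⟨a, ha⟩ := hd i
    exact ⟨a, by rw [ha, Algebra.smul_def]⟩⟩

/-- Conjugates of sufficiently divisible transvections over a localization come from elementary
matrices over the base ring. -/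
theorem exists_conj_transvection_mem (hm : 3 ≤ m) (M : Submonoid R) [Algebra R T]
    [IsLocalization M T] (γ : SpecialLinearGroup (Fin m) T) :
    ∃ s ∈ M, ∀ (r : R) (i j : Fin m) (hij : i ≠ j),
      γ * SpecialLinearGroup.transvection hij (algebraMap R T (s * r)) * γ⁻¹ ∈
        (ElemSubgroup m R).map (SpecialLinearGroup.map (algebraMap R T)) := by
  obtain ⟨d, hdM, hd⟩ := exists_common_denom M
    (Sum.elim (fun x : Fin m × Fin m => γ x.1 x.2) (fun x : Fin m × Fin m => γ⁻¹ x.1 x.2))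
  set P : T → Prop := fun t => ∃ a, algebraMap R T d * t = algebraMap R T a
  refine ⟨d ^ 4, pow_mem hdM 4, fun r i j hij => ?_⟩
  rw [← coe_mem_matrixImage]
  have key : ∀ t1 t2 t3 t4 : T, P t1 → P t2 → P t3 → P t4 →
      ∃ a, algebraMap R T a = algebraMap R T (d ^ 4 * r) * t1 * t2 * t3 * t4 := by
    rintro t1 t2 t3 t4 ⟨a1, h1⟩ ⟨a2, h2⟩ ⟨a3, h3⟩ ⟨a4, h4⟩
    refine ⟨r * a1 * a2 * a3 * a4, ?_⟩
    simp only [map_mul, map_pow, ← h1, ← h2, ← h3, ← h4]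
    ring
  refine conj_transvection_mem _ γ hij _ P (fun i j => hd (Sum.inl (i, j)))
    (fun i j => hd (Sum.inr (i, j))) ?_ ?_ ?_
  · intro r q hrq a b c e ha hb hc he
    obtain ⟨x, hx⟩ := key a b c e ha hb hc he
    exact transvection_mem_matrixImage _ hrq x hx
  · intro r q hrq a b c e ha hb hc he
    obtain ⟨x, hx⟩ := key a b c e ha hb hc he
    exact transvection_mem_matrixImage _ hrq (-x) (by rw [map_neg, hx])
  · rintro p q hpq t1 t2 t3 t4 ⟨a1, h1⟩ ⟨a2, h2⟩ ⟨a3, h3⟩ ⟨a4, h4⟩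
    obtain ⟨l, hlp, hlq⟩ := exists_ne_ne hm p q
    have : koszulBlock p q (algebraMap R T (d ^ 4 * r) * t1 * t2) t3 t4 =
        koszulBlock p q (algebraMap R T (r * a1 * a2)) (algebraMap R T a3) (algebraMap R T a4) := by
      simp only [koszulBlock, map_mul, map_pow, ← h1, ← h2, ← h3, ← h4]
      ext i j
      simp only [Matrix.smul_apply, vecMulVec_apply, Pi.add_apply, Pi.sub_apply, Pi.single_apply,
        smul_eq_mul]
      split_ifs <;> ring
    rw [this]
    exact one_add_koszulBlock_mem _ hpq hlp hlq _ _ _ rfl rfl rfl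

end Basic

section Gauss

variable {m : ℕ} {R S : Type*} [CommRing R] [CommRing S]

/-- The matrix differing from the identity only off the diagonal in column `l`, where its entries
are those of `v`. -/
def colElem (l : Fin m) (v : Fin m → R) : SpecialLinearGroup (Fin m) R :=
  ⟨1 + vecMulVec (Function.update v l 0) (Pi.single l 1), by
    rw [vecMulVec_eq Unit, det_one_add_replicateCol_mul_replicateRow]
    simp⟩

/-- The matrix differing from the identity only off the diagonal in row `l`, where its entries
are those of `v`. -/
def rowElem (l : Fin m) (v : Fin m → R) : SpecialLinearGroup (Fin m) R :=
  (colElem l v).transpose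

theorem coe_colElem (l : Fin m) (v : Fin m → R) :
    (colElem l v : Matrix (Fin m) (Fin m) R) =
      1 + vecMulVec (Function.update v l 0) (Pi.single l 1) := rfl

theorem colElem_apply (l : Fin m) (v : Fin m → R) (i j : Fin m) :
    colElem l v i j = (1 : Matrix (Fin m) (Fin m) R) i j +
      if j = l then (if i = l then 0 else v i) else 0 := by
  simp [coe_colElem, vecMulVec_apply, Function.update_apply, Pi.single_apply]

theorem rowElem_apply (l : Fin m) (v : Fin m → R) (i j : Fin m) :
    rowElem l v i j = (1 : Matrix (Fin m) (Fin m) R) i j +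
      if i = l then (if j = l then 0 else v j) else 0 := by
  rw [rowElem, Matrix.SpecialLinearGroup.coe_transpose, Matrix.transpose_apply, colElem_apply,
    ← Matrix.transpose_apply (1 : Matrix (Fin m) (Fin m) R), Matrix.transpose_one]

theorem colElem_mul_apply (l : Fin m) (v : Fin m → R) (g : SpecialLinearGroup (Fin m) R)
    (i j : Fin m) : (colElem l v * g) i j = g i j + (if i = l then 0 else v i) * g l j := by
  rw [Matrix.SpecialLinearGroup.coe_mul, coe_colElem, add_mul, one_mul, Matrix.add_apply,
    vecMulVec_mul]
  simp [vecMulVec_apply, Function.update_apply]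

theorem mul_rowElem_apply (l : Fin m) (v : Fin m → R) (g : SpecialLinearGroup (Fin m) R)
    (i j : Fin m) : (g * rowElem l v) i j = g i j + g i l * (if j = l then 0 else v j) := by
  rw [Matrix.SpecialLinearGroup.coe_mul, Matrix.mul_apply]
  simp only [rowElem_apply, mul_add, Finset.sum_add_distrib, mul_ite, mul_zero,
    Finset.sum_ite_eq', Finset.mem_univ, if_true]
  rw [← Matrix.mul_apply, mul_one]

theorem map_colElem (f : R →+* S) (l : Fin m) (v : Fin m → R) :
    SpecialLinearGroup.map f (colElem l v) = colElem l (fun i => f (v i)) := by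
  ext i j
  rw [SpecialLinearGroup.map_apply_coe, RingHom.mapMatrix_apply, Matrix.map_apply, colElem_apply,
    colElem_apply, map_add, Matrix.one_apply, Matrix.one_apply]
  split_ifs <;> simp

theorem map_rowElem (f : R →+* S) (l : Fin m) (v : Fin m → R) :
    SpecialLinearGroup.map f (rowElem l v) = rowElem l (fun i => f (v i)) := by
  ext i j
  rw [SpecialLinearGroup.map_apply_coe, RingHom.mapMatrix_apply, Matrix.map_apply, rowElem_apply,
    rowElem_apply, map_add, Matrix.one_apply, Matrix.one_apply]
  split_ifs <;> simp

theorem colElem_mul_colElem (l : Fin m) (v w : Fin m → R) :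
    colElem l v * colElem l w = colElem l (fun i => v i + w i) := by
  ext i j
  simp only [colElem_mul_apply, colElem_apply]
  by_cases hj : j = l
  · subst hj
    by_cases hi : i = j
    · simp [hi]
    · simp [hi, add_comm]
  · simp [hj, Ne.symm hj]

theorem colElem_zero (l : Fin m) : colElem l (fun _ => (0 : R)) = 1 := by
  ext i j
  simp [colElem_apply]

theorem inv_colElem (l : Fin m) (v : Fin m → R) :
    (colElem l v)⁻¹ = colElem l (fun i => -v i) := by
  rw [inv_eq_iff_mul_eq_one, colElem_mul_colElem]
  simp [colElem_zero]

theorem inv_rowElem (l : Fin m) (v : Fin m → R) :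
    (rowElem l v)⁻¹ = rowElem l (fun i => -v i) := by
  rw [inv_eq_iff_mul_eq_one]
  ext i j
  rw [mul_rowElem_apply, rowElem_apply, rowElem_apply, Matrix.one_apply, Matrix.one_apply]
  split_ifs <;> simp_all

theorem colElem_mem (l : Fin m) (v : Fin m → R) : colElem l v ∈ ElemSubgroup m R := by
  have h : (colElem l v : Matrix (Fin m) (Fin m) R) ∈ matrixImage m (RingHom.id R) := by
    have : (colElem l v : Matrix (Fin m) (Fin m) R) =
        1 + ∑ i ∈ Finset.univ.erase l, single i l (v i) := by
      ext i j
      rw [colElem_apply, Matrix.add_apply, Matrix.sum_apply]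
      congr 1
      simp only [single_apply]
      by_cases hj : j = l
      · subst hj
        by_cases hi : i = j <;> simp [hi]
      · simp [hj, Ne.symm hj]
    rw [this]
    refine one_add_sum_mem _ _ _ ?_ ?_
    · intro a _ b hb
      exact single_mul_single_of_ne _ _ _ _ (Finset.ne_of_mem_erase hb).symm _
    · intro a ha
      exact transvection_mem_matrixImage _ (Finset.ne_of_mem_erase ha) _ rfl
  obtain ⟨e, he, h⟩ := coe_mem_matrixImage.1 h
  rw [map_id] at h
  exact h ▸ he

theorem transpose_mem {g : SpecialLinearGroup (Fin m) R} (hg : g ∈ ElemSubgroup m R) :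
    g.transpose ∈ ElemSubgroup m R := by
  refine induction_right (C := fun g => g.transpose ∈ ElemSubgroup m R) ?_ ?_ hg
  · convert one_mem (ElemSubgroup m R) using 1
    ext i j
    rw [Matrix.SpecialLinearGroup.coe_transpose, Matrix.SpecialLinearGroup.coe_one,
      Matrix.transpose_one]
  · intro g _ i j hij a h
    convert mul_mem (transvection_mem hij.symm a) h using 1
    apply Subtype.ext
    rw [Matrix.SpecialLinearGroup.coe_mul, Matrix.SpecialLinearGroup.coe_transpose,
      Matrix.SpecialLinearGroup.coe_mul, Matrix.transpose_mul,
      Matrix.SpecialLinearGroup.coe_transpose, Matrix.SpecialLinearGroup.transvection_coe,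
      Matrix.SpecialLinearGroup.transvection_coe, Matrix.transpose_add, Matrix.transpose_one,
      Matrix.transpose_single]

theorem rowElem_mem (l : Fin m) (v : Fin m → R) : rowElem l v ∈ ElemSubgroup m R :=
  transpose_mem (colElem_mem l v)

/-- Gaussian elimination with a unit pivot on the diagonal. -/
theorem exists_eq_colElem_mul_mul_rowElem (g : SpecialLinearGroup (Fin m) R) (l : Fin m) (a : Rˣ)
    (ha : (a : R) = g l l) :
    ∃ b : SpecialLinearGroup (Fin m) R,
      g = colElem l (fun i => g i l * ↑a⁻¹) * b * rowElem l (fun j => ↑a⁻¹ * g l j) ∧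
      ∀ i j, b i j = if i = l ∨ j = l then (if i = j then (a : R) else 0) else
        g i j - g i l * ↑a⁻¹ * g l j := by
  refine ⟨(colElem l (fun i => g i l * ↑a⁻¹))⁻¹ * g * (rowElem l (fun j => ↑a⁻¹ * g l j))⁻¹,
    by group, fun i j => ?_⟩
  rw [inv_colElem, inv_rowElem, mul_rowElem_apply, colElem_mul_apply, colElem_mul_apply, ← ha]
  by_cases hi : i = l <;> by_cases hj : j = l
  · subst hi hj; simp [ha]
  · subst hi; simp [Ne.symm hj, hj, ← mul_assoc, ← ha]
  · subst hj; simp [hi, mul_assoc, ← ha]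
  · simp [hi, hj]; ring

theorem transvection_mul_apply {i j : Fin m} (hij : i ≠ j) (c : R)
    (g : SpecialLinearGroup (Fin m) R) (p q : Fin m) :
    (SpecialLinearGroup.transvection hij c * g) p q = g p q + if p = i then c * g j q else 0 := by
  rw [Matrix.SpecialLinearGroup.coe_mul]
  change (Matrix.transvection i j c * (g : Matrix (Fin m) (Fin m) R)) p q = _
  split_ifs with h
  · subst h
    exact transvection_mul_apply_same p j q c _
  · rw [transvection_mul_apply_of_ne i j p q h c _, add_zero]

theorem sum_inv_mul (g : SpecialLinearGroup (Fin m) R) (i j : Fin m) :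
    ∑ p, g⁻¹ i p * g p j = (1 : Matrix (Fin m) (Fin m) R) i j := by
  have := congrArg (fun x : SpecialLinearGroup (Fin m) R => x i j) (inv_mul_cancel g)
  rwa [Matrix.SpecialLinearGroup.coe_mul, Matrix.SpecialLinearGroup.coe_one,
    Matrix.mul_apply] at this

/-- Over a local ring every column of an invertible matrix has a unit entry. -/
theorem exists_isUnit_apply [IsLocalRing R] (g : SpecialLinearGroup (Fin m) R) (j : Fin m) :
    ∃ i, IsUnit (g i j) := by
  by_contra! h
  have : (1 : R) ∈ IsLocalRing.maximalIdeal R := by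
    rw [← Matrix.one_apply_eq (n := Fin m) j, ← sum_inv_mul g]
    exact Ideal.sum_mem _ fun p _ => Ideal.mul_mem_left _ _
      ((IsLocalRing.mem_maximalIdeal _).2 (h p))
  exact (IsLocalRing.mem_maximalIdeal _).1 this isUnit_one

theorem mem_of_isLocalRing_of_support [IsLocalRing R] (s : Finset (Fin m)) :
    ∀ g : SpecialLinearGroup (Fin m) R,
    (∀ i ∉ s, ∀ j, g i j = (1 : Matrix (Fin m) (Fin m) R) i j ∧
      g j i = (1 : Matrix (Fin m) (Fin m) R) j i) → g ∈ ElemSubgroup m R := by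
  induction s using Finset.induction_on with
  | empty =>
    intro g h
    have : g = 1 := by
      ext i j
      exact (h i (Finset.notMem_empty _) j).1
    exact this ▸ one_mem _
  | insert i s his ih =>
    intro g hg
    have hop : ∀ (a b : Fin m) (hab : a ≠ b), a ∈ insert i s → b ∈ insert i s → ∀ c : R,
        ∀ g : SpecialLinearGroup (Fin m) R,
        (∀ i' ∉ insert i s, ∀ j, g i' j = (1 : Matrix (Fin m) (Fin m) R) i' j ∧
          g j i' = (1 : Matrix (Fin m) (Fin m) R) j i') →
        (∀ i' ∉ insert i s, ∀ j,
          (SpecialLinearGroup.transvection hab c * g) i' j = (1 : Matrix (Fin m) (Fin m) R) i' j ∧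
          (SpecialLinearGroup.transvection hab c * g) j i' =
            (1 : Matrix (Fin m) (Fin m) R) j i') := by
      intro a b hab ha hb c g hg i' hi' j
      have h1 : i' ≠ a := fun h => hi' (h ▸ ha)
      have h2 : b ≠ i' := fun h => hi' (h ▸ hb)
      rw [transvection_mul_apply, transvection_mul_apply, if_neg h1, add_zero, (hg i' hi' b).2,
        Matrix.one_apply_ne h2]
      simpa using hg i' hi' j
    have hpivot : ∀ g : SpecialLinearGroup (Fin m) R,
        (∀ i' ∉ insert i s, ∀ j, g i' j = (1 : Matrix (Fin m) (Fin m) R) i' j ∧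
          g j i' = (1 : Matrix (Fin m) (Fin m) R) j i') → g i i = 1 → g ∈ ElemSubgroup m R := by
      intro g hg h1
      obtain ⟨b, hb, hb'⟩ := exists_eq_colElem_mul_mul_rowElem g i 1 (by simp [h1])
      rw [hb]
      refine mul_mem (mul_mem (colElem_mem _ _) (ih b ?_)) (rowElem_mem _ _)
      intro k hk j
      rw [hb', hb']
      by_cases hki : k = i
      · subst hki
        simp [Matrix.one_apply]
      · have hk' : k ∉ insert i s := by simp [hki, hk]
        rw [(hg k hk' i).1, (hg k hk' i).2, (hg k hk' j).1, (hg k hk' j).2]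
        rw [Matrix.one_apply_ne hki, Matrix.one_apply_ne (Ne.symm hki)]
        by_cases hj : j = i
        · subst hj; simp [hki, Ne.symm hki]
        · simp [hki, hj]
    have hunit : ∀ g : SpecialLinearGroup (Fin m) R,
        (∀ i' ∉ insert i s, ∀ j, g i' j = (1 : Matrix (Fin m) (Fin m) R) i' j ∧
          g j i' = (1 : Matrix (Fin m) (Fin m) R) j i') →
        ∀ r ∈ insert i s, r ≠ i → ∀ u : Rˣ, g r i = u → g ∈ ElemSubgroup m R := by
      intro g hg r hr hri u hu
      have h := hpivot _ (hop i r hri.symm (Finset.mem_insert_self _ _) hr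
        ((1 - g i i) * ↑u⁻¹) g hg) (by
          rw [transvection_mul_apply, if_pos rfl, hu, mul_assoc, Units.inv_mul]; ring)
      exact ((ElemSubgroup m R).mul_mem_cancel_left (transvection_mem _ _)).1 h
    obtain ⟨r, u, hu⟩ := exists_isUnit_apply g i
    by_cases hri : r = i
    · subst hri
      rcases s.eq_empty_or_nonempty with rfl | ⟨j, hj⟩
      · have hd : g.1 = Matrix.diagonal (fun k => g k k) := by
          ext a b
          by_cases hab : a = b
          · subst hab; simp
          · rw [Matrix.diagonal_apply_ne _ hab]
            by_cases ha : a = r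
            · have hb : b ∉ insert r (∅ : Finset (Fin m)) := by
                simpa using fun h => hab (ha.trans h.symm)
              exact (hg b hb a).2.trans (Matrix.one_apply_ne hab)
            · exact (hg a (by simpa using ha) b).1.trans (Matrix.one_apply_ne hab)
        have hdet := g.2
        rw [hd, Matrix.det_diagonal, Finset.prod_eq_single r] at hdet
        · exact hpivot g hg hdet
        · intro b _ hb
          exact (hg b (by simpa using hb) b).1.trans (Matrix.one_apply_eq _)
        · simp
      · have hjr : j ≠ r := fun h => his (h ▸ hj)
        have h := hunit _ (hop j r hjr (Finset.mem_insert_of_mem hj) (Finset.mem_insert_self _ _)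
          ((1 - g j r) * ↑u⁻¹) g hg) j (Finset.mem_insert_of_mem hj) hjr 1 (by
            rw [transvection_mul_apply, if_pos rfl, ← hu, mul_assoc, Units.inv_mul]; simp)
        exact ((ElemSubgroup m R).mul_mem_cancel_left (transvection_mem _ _)).1 h
    · by_cases hr : r ∈ insert i s
      · exact hunit g hg r hr hri u hu.symm
      · rw [(hg r hr i).1, Matrix.one_apply_ne hri] at hu
        exact absurd (hu ▸ u.isUnit) not_isUnit_zero

/-- Over a local ring, the special linear group is generated by transvections. -/
theorem mem_of_isLocalRing [IsLocalRing R] (g : SpecialLinearGroup (Fin m) R) :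
    g ∈ ElemSubgroup m R :=
  mem_of_isLocalRing_of_support Finset.univ g fun i hi => absurd (Finset.mem_univ i) hi

end Gauss

section Weight

variable {m : ℕ} {A T : Type*} [CommRing A] [CommRing T]

/-- Invertible diagonal matrices. -/
def diagUnits (m : ℕ) (T : Type*) [CommRing T] : (Fin m → Tˣ) →* GL (Fin m) T :=
  (Units.map (Matrix.diagonalRingHom (Fin m) T : (Fin m → T) →* Matrix (Fin m) (Fin m) T)).comp
    MulEquiv.piUnits.symm.toMonoidHom

theorem coe_diagUnits (u : Fin m → Tˣ) :
    (diagUnits m T u : Matrix (Fin m) (Fin m) T) = diagonal fun i => (u i : T) := rfl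

theorem coe_inv_diagUnits (u : Fin m → Tˣ) :
    (((diagUnits m T u)⁻¹ : GL (Fin m) T) : Matrix (Fin m) (Fin m) T) =
      diagonal fun i => (((u i)⁻¹ : Tˣ) : T) := by
  rw [← map_inv]
  rfl

/-- The diagonal matrix with entries `y ^ n i`. -/
def weightDiag (y : Tˣ) (n : Fin m → ℤ) : GL (Fin m) T :=
  diagUnits m T fun i => y ^ n i

theorem weightDiag_add (y : Tˣ) (n n' : Fin m → ℤ) :
    weightDiag y (fun i => n i + n' i) = weightDiag y n * weightDiag y n' := by
  rw [weightDiag, weightDiag, weightDiag, ← map_mul]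
  congr 1
  ext i
  simp [_root_.zpow_add]

theorem weightDiag_zero (y : Tˣ) : weightDiag y (fun _ : Fin m => 0) = 1 := by
  rw [weightDiag, ← map_one (diagUnits m T)]
  congr 1
  ext i
  simp

theorem weightDiag_neg (y : Tˣ) (n : Fin m → ℤ) :
    weightDiag y (fun i => -n i) = (weightDiag y n)⁻¹ := by
  rw [eq_inv_iff_mul_eq_one, ← weightDiag_add, ← weightDiag_zero y]
  simp

theorem weightDiag_mul_mul_inv_apply (y : Tˣ) (n n' : Fin m → ℤ) (B : Matrix (Fin m) (Fin m) T)
    (i j : Fin m) :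
    ((weightDiag y n : Matrix (Fin m) (Fin m) T) * B * ((weightDiag y n')⁻¹ : GL (Fin m) T)) i j =
      ↑(y ^ (n i - n' j)) * B i j := by
  rw [weightDiag, weightDiag, coe_diagUnits, coe_inv_diagUnits, mul_diagonal, diagonal_mul,
    _root_.zpow_sub]
  push_cast
  ring

/-- The image of `E_m(A)` in `GL_m(T)`. -/
def imageGL (m : ℕ) (f : A →+* T) : Subgroup (GL (Fin m) T) :=
  (ElemSubgroup m A).map (SpecialLinearGroup.toGL.comp (SpecialLinearGroup.map f))

theorem mem_imageGL_iff_coe_mem {f : A →+* T} {B : GL (Fin m) T} :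
    B ∈ imageGL m f ↔ (B : Matrix (Fin m) (Fin m) T) ∈ matrixImage m f := by
  rw [mem_matrixImage, imageGL, Subgroup.mem_map]
  exact exists_congr fun e => and_congr_right fun _ => Units.ext_iff

theorem toGL_map_mem_imageGL (f : A →+* T) {g : SpecialLinearGroup (Fin m) A}
    (hg : g ∈ ElemSubgroup m A) :
    SpecialLinearGroup.toGL (SpecialLinearGroup.map f g) ∈ imageGL m f :=
  ⟨g, hg, rfl⟩

/-- The endomorphism of the matrix ring given by conjugation by a unit. -/
def conjHom (D : GL (Fin m) T) : Matrix (Fin m) (Fin m) T →* Matrix (Fin m) (Fin m) T where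
  toFun B := D * B * (D⁻¹ : GL (Fin m) T)
  map_one' := by rw [mul_one, ← Units.val_mul, mul_inv_cancel, Units.val_one]
  map_mul' B B' := by
    have : (((D⁻¹ : GL (Fin m) T) : Matrix (Fin m) (Fin m) T)) * D = 1 := by
      rw [← Units.val_mul, inv_mul_cancel, Units.val_one]
    rw [mul_assoc (_ * B), ← mul_assoc (_ : Matrix (Fin m) (Fin m) T) (D * B'),
      ← mul_assoc (_ : Matrix (Fin m) (Fin m) T) (D : Matrix (Fin m) (Fin m) T), this, one_mul]
    simp only [mul_assoc]

theorem weightDiag_conj_one_add_koszulBlock (y : Tˣ) (n : Fin m → ℤ) {p q : Fin m} (hpq : p ≠ q)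
    (a b c a' b' c' : T) (h1 : ↑(y ^ (n p - n q)) * (a * b ^ 2) = a' * b' ^ 2)
    (h2 : ↑(y ^ (n q - n p)) * (a * c ^ 2) = a' * c' ^ 2) (h3 : a * b * c = a' * b' * c') :
    conjHom (weightDiag y n) (1 + koszulBlock p q a b c) = 1 + koszulBlock p q a' b' c' := by
  have hc : ∀ B, conjHom (weightDiag y n) (1 + B) = 1 + conjHom (weightDiag y n) B := by
    intro B
    have h1 := map_one (conjHom (weightDiag y n))
    simp only [conjHom, MonoidHom.coe_mk, OneHom.coe_mk] at h1 ⊢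
    rw [mul_add, add_mul, h1]
  rw [hc]
  congr 1
  ext i j
  refine (weightDiag_mul_mul_inv_apply y n n _ i j).trans ?_
  simp only [koszulBlock, Matrix.smul_apply, vecMulVec_apply, Pi.add_apply, Pi.sub_apply,
    Pi.single_apply, smul_eq_mul]
  have hp := hpq.symm
  by_cases hip : i = p
  · subst hip
    by_cases hji : j = i
    · subst hji
      simp [hpq]
      linear_combination h3
    · by_cases hjq : j = q
      · subst hjq
        simp [hpq, hp]
        linear_combination h1
      · simp [hji, hjq]
  · by_cases hiq : i = q
    · subst hiq
      by_cases hji : j = i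
      · subst hji
        simp [hp]
        linear_combination h3
      · by_cases hjp : j = p
        · subst hjp
          simp [hpq, hp]
          linear_combination h2
        · simp [hji, hjp]
    · simp [hip, hiq]

open Polynomial

/-- Conjugating by a diagonal matrix of nearly constant weights preserves conjugates, under
constant matrices, of transvections with coefficient divisible by the variable. -/
theorem weightDiag_conj_mem_imageGL (hm : 3 ≤ m) (φ : A[X] →+* T) (y : Tˣ) (hy : (y : T) = φ X)
    (n : Fin m → ℤ) (hn : ∀ p q, n p ≤ n q + 1) (γ : SpecialLinearGroup (Fin m) A) {i j : Fin m}
    (hij : i ≠ j) (b : A[X]) :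
    weightDiag y n * SpecialLinearGroup.toGL (SpecialLinearGroup.map φ
      (SpecialLinearGroup.map C γ * SpecialLinearGroup.transvection hij (X * b) *
        (SpecialLinearGroup.map C γ)⁻¹)) * (weightDiag y n)⁻¹ ∈ imageGL m φ := by
  have hE : SpecialLinearGroup.map φ (SpecialLinearGroup.map C γ *
      SpecialLinearGroup.transvection hij (X * b) * (SpecialLinearGroup.map C γ)⁻¹) =
      SpecialLinearGroup.map φ (SpecialLinearGroup.map C γ) *
        SpecialLinearGroup.transvection hij (φ (X * b)) *
          (SpecialLinearGroup.map φ (SpecialLinearGroup.map C γ))⁻¹ := by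
    rw [map_mul, map_mul, map_inv, map_transvection]
  rw [mem_imageGL_iff_coe_mem, hE]
  set P : T → Prop := fun t => ∃ a : A, φ (C a) = t
  have key : ∀ r q : Fin m, ∀ t1 t2 t3 t4 : T, P t1 → P t2 → P t3 → P t4 →
      ∃ a, φ a = ↑(y ^ (n r - n q)) * (φ (X * b) * t1 * t2 * t3 * t4) := by
    rintro r q _ _ _ _ ⟨a1, rfl⟩ ⟨a2, rfl⟩ ⟨a3, rfl⟩ ⟨a4, rfl⟩
    obtain ⟨k, hk⟩ := Int.eq_ofNat_of_zero_le (by linarith [hn q r] : 0 ≤ n r - n q + 1)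
    refine ⟨X ^ k * b * C a1 * C a2 * C a3 * C a4, ?_⟩
    have : ((y ^ (n r - n q) : Tˣ) : T) * φ X = φ X ^ k := by
      rw [← hy, ← Units.val_mul, ← _root_.zpow_add_one, hk, ← Units.val_pow_eq_pow_val]
      simp
    simp only [map_mul, map_pow, ← this]
    ring
  have htr : ∀ (r q : Fin m) (hrq : r ≠ q) (t : T),
      conjHom (weightDiag y n) (transvection r q t) =
        transvection r q (↑(y ^ (n r - n q)) * t) := by
    intro r q hrq t
    ext i j
    refine (weightDiag_mul_mul_inv_apply y n n _ i j).trans ?_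
    simp only [transvection, Matrix.add_apply, Matrix.one_apply, single_apply]
    by_cases h : i = j
    · subst h
      have : ¬ (r = i ∧ q = i) := fun h => hrq (h.1.trans h.2.symm)
      simp [this]
    · by_cases h' : r = i ∧ q = j
      · simp [h, h']
      · simp [h, h']
  refine conj_transvection_mem ((matrixImage m φ).comap (conjHom (weightDiag y n)))
    (SpecialLinearGroup.map φ (SpecialLinearGroup.map C γ)) hij _ P
    (fun i j => ⟨γ i j, by simp⟩) (fun i j => ⟨γ⁻¹ i j, by rw [← map_inv, ← map_inv]; rfl⟩) ?_ ?_ ?_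
  · intro r q hrq t1 t2 t3 t4 h1 h2 h3 h4
    obtain ⟨a, ha⟩ := key r q t1 t2 t3 t4 h1 h2 h3 h4
    rw [Submonoid.mem_comap, htr r q hrq]
    exact transvection_mem_matrixImage _ hrq a ha
  · intro r q hrq t1 t2 t3 t4 h1 h2 h3 h4
    obtain ⟨a, ha⟩ := key r q t1 t2 t3 t4 h1 h2 h3 h4
    rw [Submonoid.mem_comap, htr r q hrq]
    exact transvection_mem_matrixImage _ hrq (-a) (by rw [map_neg, ha, mul_neg])
  · rintro p q hpq _ _ _ _ ⟨a1, rfl⟩ ⟨a2, rfl⟩ ⟨a3, rfl⟩ ⟨a4, rfl⟩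
    obtain ⟨l, hlp, hlq⟩ := exists_ne_ne hm p q
    rw [Submonoid.mem_comap]
    have h : n p - n q = 0 ∨ n p - n q = 1 ∨ n p - n q = -1 := by
      have := hn p q; have := hn q p; lia
    have hyi : ((y⁻¹ : Tˣ) : T) * φ X = 1 := by rw [← hy, Units.inv_mul]
    rcases h with h | h | h
    · rw [weightDiag_conj_one_add_koszulBlock y n hpq _ _ _ (φ (X * b * C a1 * C a2)) (φ (C a3))
        (φ (C a4))]
      · exact one_add_koszulBlock_mem _ hpq hlp hlq _ _ _ rfl rfl rfl
      · simp [h]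
      · rw [← neg_sub, h]; simp
      · simp
    · rw [weightDiag_conj_one_add_koszulBlock y n hpq _ _ _ (φ (b * C a1 * C a2)) (φ (X * C a3))
        (φ (C a4))]
      · exact one_add_koszulBlock_mem _ hpq hlp hlq _ _ _ rfl rfl rfl
      · simp [h, hy]; ring
      · rw [← neg_sub, h]; simp
        linear_combination (φ b * φ (C a1) * φ (C a2) * φ (C a4) ^ 2) * hyi
      · simp; ring
    · rw [weightDiag_conj_one_add_koszulBlock y n hpq _ _ _ (φ (b * C a1 * C a2)) (φ (C a3))
        (φ (X * C a4))]
      · exact one_add_koszulBlock_mem _ hpq hlp hlq _ _ _ rfl rfl rfl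
      · simp [h]
        linear_combination (φ b * φ (C a1) * φ (C a2) * φ (C a3) ^ 2) * hyi
      · rw [← neg_sub, h]; simp [hy]; ring
      · simp; ring

/-- The constant part `g(0)` of a polynomial matrix, viewed as a constant polynomial matrix. -/
noncomputable abbrev constPart (g : SpecialLinearGroup (Fin m) A[X]) :
    SpecialLinearGroup (Fin m) A[X] :=
  SpecialLinearGroup.map C (SpecialLinearGroup.map constantCoeff g)

theorem transvection_mul_transvection {i j : Fin m} (hij : i ≠ j) (a b : A) :
    SpecialLinearGroup.transvection hij (a + b) =
      SpecialLinearGroup.transvection hij a * SpecialLinearGroup.transvection hij b :=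
  SpecialLinearGroup.transvection_add hij a b

theorem mul_transvection_mul_inv_constPart (g : SpecialLinearGroup (Fin m) A[X]) {i j : Fin m}
    (hij : i ≠ j) (a : A[X]) :
    (g * SpecialLinearGroup.transvection hij a) *
        (constPart (g * SpecialLinearGroup.transvection hij a))⁻¹ =
      (g * (constPart g)⁻¹) *
        (constPart g * SpecialLinearGroup.transvection hij (X * a.divX) * (constPart g)⁻¹) := by
  have h : SpecialLinearGroup.transvection hij a =
      SpecialLinearGroup.transvection hij (X * a.divX) *
        constPart (SpecialLinearGroup.transvection hij a) := by
    rw [constPart, map_transvection, map_transvection, ← transvection_mul_transvection,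
      mul_comm X, constantCoeff_apply, divX_mul_X_add]
  have h' : constPart (g * SpecialLinearGroup.transvection hij a) =
      constPart g * constPart (SpecialLinearGroup.transvection hij a) := by
    simp only [constPart, map_mul]
  rw [h']
  nth_rw 1 [h]
  group

theorem weightDiag_conj_mul_inv_constPart_mem (hm : 3 ≤ m) (φ : A[X] →+* T) (y : Tˣ)
    (hy : (y : T) = φ X) (n : Fin m → ℤ) (hn : ∀ p q, n p ≤ n q + 1)
    {g : SpecialLinearGroup (Fin m) A[X]} (hg : g ∈ ElemSubgroup m A[X]) :
    weightDiag y n * SpecialLinearGroup.toGL (SpecialLinearGroup.map φ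
      (g * (constPart g)⁻¹)) * (weightDiag y n)⁻¹ ∈ imageGL m φ := by
  refine induction_right (C := fun g => weightDiag y n * SpecialLinearGroup.toGL
    (SpecialLinearGroup.map φ (g * (constPart g)⁻¹)) * (weightDiag y n)⁻¹ ∈ imageGL m φ) ?_ ?_ hg
  · simp only [constPart, map_one, mul_one, inv_one, mul_inv_cancel, one_mem]
  · intro g hg i j hij a h
    rw [mul_transvection_mul_inv_constPart]
    have := mul_mem h (weightDiag_conj_mem_imageGL hm φ y hy n hn
      (SpecialLinearGroup.map constantCoeff g) hij a.divX)
    convert this using 1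
    simp only [map_mul]
    group

theorem weightDiag_conj_inv_constPart_mul_mem (hm : 3 ≤ m) (φ : A[X] →+* T) (y : Tˣ)
    (hy : (y : T) = φ X) (n : Fin m → ℤ) (hn : ∀ p q, n p ≤ n q + 1)
    {g : SpecialLinearGroup (Fin m) A[X]} (hg : g ∈ ElemSubgroup m A[X]) :
    weightDiag y n * SpecialLinearGroup.toGL (SpecialLinearGroup.map φ
      ((constPart g)⁻¹ * g)) * (weightDiag y n)⁻¹ ∈ imageGL m φ := by
  have := inv_mem (weightDiag_conj_mul_inv_constPart_mem hm φ y hy n hn (inv_mem hg))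
  convert this using 1
  simp only [constPart, map_mul, map_inv]
  group

end Weight

section Swap

variable {m : ℕ} {A : Type*} [CommRing A]

/-- A monomial matrix exchanging two rows, up to sign. -/
def swapElem {i l : Fin m} (h : i ≠ l) : SpecialLinearGroup (Fin m) A :=
  SpecialLinearGroup.transvection h.symm 1 * (SpecialLinearGroup.transvection h (-1) *
    SpecialLinearGroup.transvection h.symm 1)

theorem swapElem_mul_apply {i l : Fin m} (h : i ≠ l) (g : SpecialLinearGroup (Fin m) A)
    (p q : Fin m) :
    (swapElem h * g : SpecialLinearGroup (Fin m) A) p q =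
      if p = l then g i q else if p = i then -g l q else g p q := by
  rw [swapElem, mul_assoc, mul_assoc]
  simp only [transvection_mul_apply]
  by_cases hp : p = l
  · subst hp
    simp [h, h.symm]
  · by_cases hp' : p = i
    · subst hp'
      simp [h]
    · simp [hp, hp']

end Swap

section TwoCharts

open Polynomial

/-- Two polynomial charts `pos`, `neg` over a local ring `A`, with a common target in which their
variables are mutually inverse, together with a reduction map. -/
structure TwoCharts (A T F : Type*) [CommRing A] [IsLocalRing A] [CommRing T] [CommRing F] where
  /-- the first chart -/
  pos : A[X] →+* T
  /-- the second chart -/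
  neg : A[X] →+* T
  /-- the coordinate of the first chart -/
  y : Tˣ
  /-- the reduction map -/
  red : T →+* F
  neg_C : ∀ a, neg (C a) = pos (C a)
  pos_X : pos X = y
  neg_X : neg X = (y⁻¹ : Tˣ)
  red_pos_C : ∀ a ∈ IsLocalRing.maximalIdeal A, red (pos (C a)) = 0
  constantCoeff_mem : ∀ p, red (neg p) = 0 → constantCoeff p ∈ IsLocalRing.maximalIdeal A

namespace TwoCharts

variable {m : ℕ} {A T F : Type*} [CommRing A] [IsLocalRing A] [CommRing T] [CommRing F]
  (D : TwoCharts A T F)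

/-- The embedding of the constant matrices. -/
noncomputable def const (m : ℕ) : SpecialLinearGroup (Fin m) A →* GL (Fin m) T :=
  SpecialLinearGroup.toGL.comp (SpecialLinearGroup.map (D.pos.comp C))

/-- The kernel of the reduction. -/
def ker (m : ℕ) : Subgroup (GL (Fin m) T) :=
  (GeneralLinearGroup.map D.red).ker

instance : (D.ker m).Normal := by
  unfold ker
  infer_instance

theorem const_apply (b : SpecialLinearGroup (Fin m) A) (i j : Fin m) :
    (D.const m b : Matrix (Fin m) (Fin m) T) i j = D.pos (C (b i j)) := rfl

theorem const_eq_pos (b : SpecialLinearGroup (Fin m) A) :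
    D.const m b = SpecialLinearGroup.toGL (SpecialLinearGroup.map D.pos
      (SpecialLinearGroup.map C b)) := by
  rw [map_map]
  rfl

theorem const_eq_neg (b : SpecialLinearGroup (Fin m) A) :
    D.const m b = SpecialLinearGroup.toGL (SpecialLinearGroup.map D.neg
      (SpecialLinearGroup.map C b)) := by
  have : D.pos.comp C = D.neg.comp C := RingHom.ext fun a => (D.neg_C a).symm
  rw [map_map, const, this]
  rfl

theorem const_mem_pos (b : SpecialLinearGroup (Fin m) A) : D.const m b ∈ imageGL m D.pos := by
  rw [const_eq_pos]
  exact toGL_map_mem_imageGL _ (map_mem _ (mem_of_isLocalRing b))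

theorem const_mem_neg (b : SpecialLinearGroup (Fin m) A) : D.const m b ∈ imageGL m D.neg := by
  rw [const_eq_neg]
  exact toGL_map_mem_imageGL _ (map_mem _ (mem_of_isLocalRing b))

theorem mem_ker_iff {g : GL (Fin m) T} :
    g ∈ D.ker m ↔ ∀ i j, D.red ((g : Matrix (Fin m) (Fin m) T) i j) =
      (1 : Matrix (Fin m) (Fin m) F) i j := by
  rw [ker, MonoidHom.mem_ker, Units.ext_iff]
  exact Matrix.ext_iff.symm

theorem weightDiag_conj_const_apply (n : Fin m → ℤ) (b : SpecialLinearGroup (Fin m) A)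
    (i j : Fin m) :
    ((weightDiag D.y n * D.const m b * (weightDiag D.y n)⁻¹ : GL (Fin m) T) :
      Matrix (Fin m) (Fin m) T) i j = ↑(D.y ^ (n i - n j)) * D.pos (C (b i j)) :=
  weightDiag_mul_mul_inv_apply _ _ _ _ _ _

theorem weightDiag_conj_const_of_support (n : Fin m → ℤ) (b : SpecialLinearGroup (Fin m) A)
    (hb : ∀ i j, n i ≠ n j → b i j = 0) :
    weightDiag D.y n * D.const m b * (weightDiag D.y n)⁻¹ = D.const m b := by
  refine Units.ext (Matrix.ext fun i j => ?_)
  rw [weightDiag_conj_const_apply, const_apply]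
  by_cases h : n i = n j
  · simp [h]
  · simp [hb i j h]

theorem weightDiag_conj_const_rowElem_mem (n : Fin m → ℤ) (l : Fin m) (v : Fin m → A)
    (hv : ∀ j, v j ≠ 0 → n j ≤ n l) :
    weightDiag D.y n * D.const m (rowElem l v) * (weightDiag D.y n)⁻¹ ∈ imageGL m D.pos := by
  have : weightDiag D.y n * D.const m (rowElem l v) * (weightDiag D.y n)⁻¹ =
      SpecialLinearGroup.toGL (SpecialLinearGroup.map D.pos
        (rowElem l fun j => X ^ (n l - n j).toNat * C (v j))) := by
    refine Units.ext (Matrix.ext fun i j => ?_)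
    rw [weightDiag_conj_const_apply, map_rowElem, Matrix.SpecialLinearGroup.coe_GL_coe_matrix,
      rowElem_apply, rowElem_apply, Matrix.one_apply, Matrix.one_apply]
    by_cases hij : i = j
    · subst hij
      by_cases hl : i = l <;> simp [hl]
    · by_cases hl : i = l
      · subst hl
        by_cases h0 : v j = 0
        · simp [h0, hij]
        · have hk : ((D.y ^ (n i - n j) : Tˣ) : T) = D.pos X ^ (n i - n j).toNat := by
            rw [pos_X, ← Units.val_pow_eq_pow_val, ← zpow_natCast,
              Int.toNat_of_nonneg (by linarith [hv j h0])]
          simp only [hij, Ne.symm hij, if_false, if_true, zero_add, map_mul, map_pow, hk, mul_comm]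
      · simp [hij, hl]
  rw [this]
  exact toGL_map_mem_imageGL _ (rowElem_mem _ _)

theorem weightDiag_conj_const_colElem_mem (n : Fin m → ℤ) (l : Fin m) (v : Fin m → A)
    (hv : ∀ i, v i ≠ 0 → n i ≤ n l) :
    weightDiag D.y n * D.const m (colElem l v) * (weightDiag D.y n)⁻¹ ∈ imageGL m D.neg := by
  have : weightDiag D.y n * D.const m (colElem l v) * (weightDiag D.y n)⁻¹ =
      SpecialLinearGroup.toGL (SpecialLinearGroup.map D.neg
        (colElem l fun i => X ^ (n l - n i).toNat * C (v i))) := by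
    refine Units.ext (Matrix.ext fun i j => ?_)
    rw [weightDiag_conj_const_apply, map_colElem, Matrix.SpecialLinearGroup.coe_GL_coe_matrix,
      colElem_apply, colElem_apply, Matrix.one_apply, Matrix.one_apply]
    by_cases hij : i = j
    · subst hij
      by_cases hl : i = l <;> simp [hl]
    · by_cases hl : j = l
      · subst hl
        by_cases h0 : v i = 0
        · simp [h0, hij]
        · have hk : ((D.y ^ (n i - n j) : Tˣ) : T) = D.neg X ^ (n j - n i).toNat := by
            rw [neg_X, ← Units.val_pow_eq_pow_val, ← zpow_natCast,
              Int.toNat_of_nonneg (by linarith [hv i h0]), _root_.inv_zpow, ← _root_.zpow_neg,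
              neg_sub]
          simp only [hij, if_false, if_true, zero_add, map_mul, map_pow, hk, neg_C]
      · simp [hij, hl]
  rw [this]
  exact toGL_map_mem_imageGL _ (colElem_mem _ _)

/-- The weight concentrated at `l`. -/
def unitWeight (l : Fin m) : Fin m → ℤ := Pi.single l 1

theorem unitWeight_apply (l i : Fin m) : unitWeight l i = if i = l then 1 else 0 := by
  simp [unitWeight, Pi.single_apply]

theorem unitWeight_le (l i j : Fin m) : unitWeight l i ≤ unitWeight l j + 1 := by
  rw [unitWeight_apply, unitWeight_apply]
  split_ifs <;> simp

theorem unitWeight_le_self (l i : Fin m) : unitWeight l i ≤ unitWeight l l := by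
  rw [unitWeight_apply, unitWeight_apply, if_pos rfl]
  split_ifs <;> simp

theorem weightDiag_conj_const_mem_of_col_diag (b : SpecialLinearGroup (Fin m) A) (l : Fin m)
    (hl : IsUnit (b l l)) (hb : ∀ i, i ≠ l → b i l = 0) :
    weightDiag D.y (unitWeight l) * D.const m b * (weightDiag D.y (unitWeight l))⁻¹ ∈
      imageGL m D.pos := by
  obtain ⟨a, ha⟩ := hl
  obtain ⟨b', hbb', hb'⟩ := exists_eq_colElem_mul_mul_rowElem b l a ha
  have h1 : colElem l (fun i => b i l * ↑a⁻¹) = 1 := by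
    rw [← colElem_zero l]
    ext i j
    rw [colElem_apply, colElem_apply]
    by_cases hi : i = l
    · simp [hi]
    · simp [hb i hi]
  rw [h1, one_mul] at hbb'
  have h2 := D.weightDiag_conj_const_of_support (unitWeight l) b' (by
    intro i j hij
    rw [unitWeight_apply, unitWeight_apply] at hij
    rw [hb']
    by_cases hi : i = l
    · have hj : j ≠ l := by rintro rfl; exact hij (by simp [hi])
      simp [hi, Ne.symm hj]
    · have hj : j = l := by by_contra hj; exact hij (by simp [hi, hj])
      simp [hi, hj])
  have h3 := D.weightDiag_conj_const_rowElem_mem (unitWeight l) l (fun j => ↑a⁻¹ * b l j)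
    fun j _ => unitWeight_le_self l j
  have h4 : D.const m b = D.const m b' * D.const m (rowElem l (fun j => ↑a⁻¹ * b l j)) := by
    rw [← map_mul, ← hbb']
  rw [h4, show ∀ x y z : GL (Fin m) T, x * (y * z) * x⁻¹ = (x * y * x⁻¹) * (x * z * x⁻¹) by
    intros; group, h2]
  exact mul_mem (D.const_mem_pos b') h3

theorem weightDiag_mul_const_mul_inv_mem_of_col (b : SpecialLinearGroup (Fin m) A) (i l : Fin m)
    (hl : IsUnit (b i l)) (hb : ∀ j, j ≠ i → b j l = 0) :
    weightDiag D.y (unitWeight i) * D.const m b * (weightDiag D.y (unitWeight l))⁻¹ ∈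
      imageGL m D.pos := by
  by_cases h : i = l
  · subst h
    exact D.weightDiag_conj_const_mem_of_col_diag b i hl hb
  · have h1 : weightDiag D.y (unitWeight l) * D.const m (swapElem h) *
        (weightDiag D.y (unitWeight i))⁻¹ = D.const m (swapElem h) := by
      refine Units.ext (Matrix.ext fun p q => ?_)
      rw [Units.val_mul, Units.val_mul, weightDiag_mul_mul_inv_apply, const_apply,
        ← mul_one (swapElem h),
        swapElem_mul_apply, Matrix.SpecialLinearGroup.coe_one, unitWeight_apply, unitWeight_apply]
      simp only [Matrix.one_apply]
      by_cases hp : p = l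
      · by_cases hq : q = i
        · simp [hp, hq]
        · simp [hp, hq, Ne.symm hq]
      · by_cases hq : q = i
        · simp only [hq, if_neg hp, if_neg (Ne.symm h)]
          split_ifs <;> simp
        · simp [hp, hq]
    have h2 := D.weightDiag_conj_const_mem_of_col_diag (swapElem h * b) l
      (by rwa [swapElem_mul_apply, if_pos rfl]) (by
        intro j hj
        rw [swapElem_mul_apply, if_neg hj]
        split_ifs with hji
        · rw [hb l (Ne.symm h), neg_zero]
        · exact hb j hji)
    have h3 := mul_mem (inv_mem (D.const_mem_pos (swapElem h))) h2
    nth_rw 1 [← h1] at h3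
    convert h3 using 1
    rw [map_mul]
    group

/-- Conjugation by a fundamental weight, of an element of the second chart that reduces to `1`. -/
theorem weightDiag_conj_mem_mul (hm : 3 ≤ m) (l : Fin m) {u : GL (Fin m) T}
    (hu : u ∈ imageGL m D.neg) (hu' : u ∈ D.ker m) :
    ∃ p ∈ imageGL m D.pos, ∃ v ∈ imageGL m D.neg, v ∈ D.ker m ∧
      weightDiag D.y (unitWeight l) * u * (weightDiag D.y (unitWeight l))⁻¹ = p * v := by
  obtain ⟨ũ, hũ, rfl⟩ := hu
  set W := weightDiag D.y (unitWeight l) with hW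
  set c := SpecialLinearGroup.map constantCoeff ũ with hc
  have hv : W * SpecialLinearGroup.toGL (SpecialLinearGroup.map D.neg ((constPart ũ)⁻¹ * ũ)) * W⁻¹ ∈
      imageGL m D.neg := by
    have := weightDiag_conj_inv_constPart_mul_mem hm D.neg D.y⁻¹ D.neg_X.symm
      (fun i => -unitWeight l i) (fun p q => by linarith [unitWeight_le l q p]) hũ
    have h : weightDiag D.y⁻¹ (fun i => -unitWeight l i) = W := by
      rw [hW, weightDiag, weightDiag]
      simp
    rwa [h] at this
  have hcm : ∀ i j, c i j - (1 : Matrix (Fin m) (Fin m) A) i j ∈ IsLocalRing.maximalIdeal A := by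
    intro i j
    have h := D.constantCoeff_mem (ũ i j - C ((1 : Matrix (Fin m) (Fin m) A) i j)) (by
      have := D.mem_ker_iff.1 hu' i j
      rw [map_sub, map_sub, sub_eq_zero]
      refine this.trans ?_
      rw [Matrix.one_apply, Matrix.one_apply]
      split_ifs <;> simp)
    simpa [hc] using h
  have hcker : ∀ b : SpecialLinearGroup (Fin m) A,
      (∀ i j, b i j - (1 : Matrix (Fin m) (Fin m) A) i j ∈ IsLocalRing.maximalIdeal A) →
      D.const m b ∈ D.ker m := by
    intro b hb
    rw [mem_ker_iff]
    intro i j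
    have := D.red_pos_C _ (hb i j)
    rw [map_sub, map_sub, map_sub, sub_eq_zero] at this
    rw [const_apply, this, Matrix.one_apply, Matrix.one_apply]
    split_ifs <;> simp
  have hinv : ∀ i j, c⁻¹ i j - (1 : Matrix (Fin m) (Fin m) A) i j ∈ IsLocalRing.maximalIdeal A := by
    intro i j
    have h1 := Ideal.sum_mem (IsLocalRing.maximalIdeal A) (t := Finset.univ)
      (f := fun p => c⁻¹ i p * (c p j - (1 : Matrix (Fin m) (Fin m) A) p j))
      fun p _ => Ideal.mul_mem_left _ _ (hcm p j)
    simp only [mul_sub, Finset.sum_sub_distrib, sum_inv_mul] at h1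
    rw [← Matrix.mul_apply, mul_one] at h1
    simpa using neg_mem h1
  have hll : IsUnit (c⁻¹ l l) := by
    by_contra h
    have h' := hinv l l
    rw [Matrix.one_apply_eq] at h'
    have := sub_mem ((IsLocalRing.mem_maximalIdeal _).2 h) h'
    rw [sub_sub_cancel] at this
    exact (IsLocalRing.mem_maximalIdeal _).1 this isUnit_one
  obtain ⟨a, ha⟩ := hll
  obtain ⟨b, hcb, hb⟩ := exists_eq_colElem_mul_mul_rowElem c⁻¹ l a ha
  set V := colElem l (fun i => c⁻¹ i l * ↑a⁻¹)
  set U := rowElem l (fun j => ↑a⁻¹ * c⁻¹ l j)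
  have hc' : c = U⁻¹ * b⁻¹ * V⁻¹ := by
    rw [← inv_inv c, hcb]
    group
  have hU : D.const m U ∈ D.ker m := hcker _ fun i j => by
    rw [rowElem_apply, add_sub_cancel_left]
    split_ifs with h1 h2
    · exact zero_mem _
    · have := hinv l j
      rw [Matrix.one_apply_ne (Ne.symm h2), sub_zero] at this
      exact Ideal.mul_mem_left _ _ this
    · exact zero_mem _
  have hUc : W * D.const m U * W⁻¹ ∈ imageGL m D.pos :=
    D.weightDiag_conj_const_rowElem_mem _ _ _ fun j _ => unitWeight_le_self l j
  have hVc : W * D.const m V * W⁻¹ ∈ imageGL m D.neg :=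
    D.weightDiag_conj_const_colElem_mem _ _ _ fun j _ => unitWeight_le_self l j
  have hbc : W * D.const m b * W⁻¹ = D.const m b :=
    D.weightDiag_conj_const_of_support (unitWeight l) b (by
      intro i j hij
      rw [unitWeight_apply, unitWeight_apply] at hij
      rw [hb]
      by_cases hi : i = l
      · have hj : j ≠ l := by rintro rfl; exact hij (by simp [hi])
        simp [hi, Ne.symm hj]
      · have hj : j = l := by by_contra hj; exact hij (by simp [hi, hj])
        simp [hi, hj])
  have h1 : SpecialLinearGroup.map D.neg ũ = SpecialLinearGroup.map D.neg (constPart ũ) *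
      SpecialLinearGroup.map D.neg ((constPart ũ)⁻¹ * ũ) := by
    rw [← map_mul, mul_inv_cancel_left]
  have h2 : SpecialLinearGroup.toGL (SpecialLinearGroup.map D.neg (constPart ũ)) =
      (D.const m U)⁻¹ * (D.const m b)⁻¹ * (D.const m V)⁻¹ := by
    rw [← map_inv, ← map_inv, ← map_inv, ← map_mul, ← map_mul, ← hc', const_eq_neg]
  have hfac : W * SpecialLinearGroup.toGL (SpecialLinearGroup.map D.neg ũ) * W⁻¹ =
      (W * D.const m U * W⁻¹)⁻¹ * ((D.const m b)⁻¹ * (W * D.const m V * W⁻¹)⁻¹ *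
        (W * SpecialLinearGroup.toGL
          (SpecialLinearGroup.map D.neg ((constPart ũ)⁻¹ * ũ)) * W⁻¹)) := by
    have hbc' : (D.const m b)⁻¹ = W * (D.const m b)⁻¹ * W⁻¹ := by
      nth_rw 1 [← hbc]
      group
    rw [hbc', h1, map_mul, h2]
    group
  have hconj : W * SpecialLinearGroup.toGL (SpecialLinearGroup.map D.neg ũ) * W⁻¹ ∈ D.ker m :=
    Subgroup.Normal.conj_mem inferInstance _ hu' W
  have hUker : W * D.const m U * W⁻¹ ∈ D.ker m :=
    Subgroup.Normal.conj_mem inferInstance _ hU W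
  refine ⟨_, inv_mem hUc, _, mul_mem (mul_mem (inv_mem (D.const_mem_neg b)) (inv_mem hVc)) hv, ?_,
    hfac⟩
  have := mul_mem hUker hconj
  rwa [hfac, mul_inv_cancel_left] at this

end TwoCharts
end TwoCharts

section TwoCharts

open Polynomial

namespace TwoCharts

variable {m : ℕ} {A T F : Type*} [CommRing A] [IsLocalRing A] [CommRing T] [CommRing F]
  (D : TwoCharts A T F)

/-- Products of elements of the first chart, the second chart and diagonal matrices. -/
def prodSet (m : ℕ) : Set (GL (Fin m) T) :=
  {g | ∃ p ∈ imageGL m D.pos, ∃ u ∈ imageGL m D.neg, u ∈ D.ker m ∧ ∃ n : Fin m → ℤ,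
    ∃ q ∈ imageGL m D.neg, g = p * u * weightDiag D.y n * q}

theorem mul_mem_prodSet {p g : GL (Fin m) T} (hp : p ∈ imageGL m D.pos) (hg : g ∈ D.prodSet m) :
    p * g ∈ D.prodSet m := by
  obtain ⟨p', hp', u, hu, hu', n, q, hq, rfl⟩ := hg
  exact ⟨p * p', mul_mem hp hp', u, hu, hu', n, q, hq, by group⟩

theorem weightDiag_const_mul (y : Tˣ) (k : ℤ) (g : GL (Fin m) T) :
    weightDiag y (fun _ => k) * g = g * weightDiag y (fun _ => k) := by
  refine Units.ext ?_
  rw [Units.val_mul, Units.val_mul, weightDiag, coe_diagUnits]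
  ext i j
  rw [diagonal_mul, mul_diagonal, mul_comm]

theorem weightDiag_const_mul_mem_prodSet (k : ℤ) {g : GL (Fin m) T} (hg : g ∈ D.prodSet m) :
    weightDiag D.y (fun _ => k) * g ∈ D.prodSet m := by
  obtain ⟨p, hp, u, hu, hu', n, q, hq, rfl⟩ := hg
  refine ⟨p, hp, u, hu, hu', fun i => k + n i, q, hq, ?_⟩
  rw [weightDiag_add, ← mul_assoc (p * u), ← weightDiag_const_mul]
  group

theorem const_mem_ker {b : SpecialLinearGroup (Fin m) A}
    (hb : ∀ i j, b i j - (1 : Matrix (Fin m) (Fin m) A) i j ∈ IsLocalRing.maximalIdeal A) :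
    D.const m b ∈ D.ker m := by
  rw [mem_ker_iff]
  intro i j
  have := D.red_pos_C _ (hb i j)
  rw [map_sub, map_sub, map_sub, sub_eq_zero] at this
  rw [const_apply, this, Matrix.one_apply, Matrix.one_apply]
  split_ifs <;> simp

theorem unitWeight_const_mul_mem_prodSet (hm : 3 ≤ m) (i : Fin m)
    (c : SpecialLinearGroup (Fin m) A) {u : GL (Fin m) T} (hu : u ∈ imageGL m D.neg)
    (hu' : u ∈ D.ker m) (n : Fin m → ℤ) {q : GL (Fin m) T} (hq : q ∈ imageGL m D.neg) :
    weightDiag D.y (unitWeight i) * D.const m c * u * weightDiag D.y n * q ∈ D.prodSet m := by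
  classical
  obtain ⟨l, hl, hmin⟩ := Finset.exists_min_image
    (Finset.univ.filter fun l => IsUnit (c⁻¹ l i)) n (by
      obtain ⟨l, hl⟩ := exists_isUnit_apply c⁻¹ i
      exact ⟨l, by simpa using hl⟩)
  obtain ⟨a, ha⟩ := (Finset.mem_filter.1 hl).2
  have hmin' : ∀ j, IsUnit (c⁻¹ j i) → n l ≤ n j := fun j hj =>
    hmin j (Finset.mem_filter.2 ⟨Finset.mem_univ j, hj⟩)
  set s : Fin m → A := fun j => ↑a⁻¹ * c⁻¹ j i with hs
  set s₁ : Fin m → A := fun j => if IsUnit (c⁻¹ j i) then s j else 0 with hs₁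
  set s₂ : Fin m → A := fun j => if IsUnit (c⁻¹ j i) then 0 else s j with hs₂
  set b := c * colElem l s with hb
  set V := colElem l (fun j => -s₁ j) with hV
  set K := colElem l (fun j => -s₂ j) with hK
  have hbKV : c = b * K * V := by
    have : colElem l s * (K * V) = 1 := by
      rw [hK, hV, colElem_mul_colElem, colElem_mul_colElem, ← colElem_zero l]
      congr 1
      ext j
      simp only [hs₁, hs₂]
      split_ifs <;> ring
    rw [hb, mul_assoc, mul_assoc, this, mul_one]
  have hcol : ∀ p, b p l = if p = i then ↑a⁻¹ else 0 := by
    intro p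
    rw [hb, Matrix.SpecialLinearGroup.coe_mul, Matrix.mul_apply]
    have h1 : ∀ j, colElem l s j l = ↑a⁻¹ * c⁻¹ j i := by
      intro j
      rw [colElem_apply, if_pos rfl, Matrix.one_apply]
      by_cases hj : j = l
      · subst hj
        simp [← ha]
      · simp [hj, hs]
    have h2 := congrArg (fun x : SpecialLinearGroup (Fin m) A => x p i) (mul_inv_cancel c)
    rw [Matrix.SpecialLinearGroup.coe_mul, Matrix.SpecialLinearGroup.coe_one,
      Matrix.mul_apply, Matrix.one_apply] at h2
    simp_rw [h1, mul_left_comm _ (↑a⁻¹ : A), ← Finset.mul_sum]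
    rw [h2, mul_ite, mul_one, mul_zero]
  have h1 := D.weightDiag_mul_const_mul_inv_mem_of_col b i l (by rw [hcol]; simp)
    (fun j hj => by rw [hcol, if_neg hj])
  have hKker : D.const m K ∈ D.ker m := D.const_mem_ker fun p j => by
    rw [hK, colElem_apply, add_sub_cancel_left]
    split_ifs with h h'
    · exact zero_mem _
    · simp only [hs₂]
      split_ifs with h''
      · simp
      · exact neg_mem (Ideal.mul_mem_left _ _ ((IsLocalRing.mem_maximalIdeal _).2 h''))
    · exact zero_mem _
  obtain ⟨p, hp, v, hv, hv', hpv⟩ := D.weightDiag_conj_mem_mul hm l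
    (u := D.const m K * (D.const m V * u * (D.const m V)⁻¹))
    (mul_mem (D.const_mem_neg K) (mul_mem (mul_mem (D.const_mem_neg V) hu)
      (inv_mem (D.const_mem_neg V))))
    (mul_mem hKker (Subgroup.Normal.conj_mem inferInstance _ hu' _))
  have h2 := D.weightDiag_conj_const_colElem_mem (fun j => -n j) l (fun j => -s₁ j) (by
    intro j hj
    simp only [hs₁] at hj
    split_ifs at hj with h
    · simpa using hmin' j h
    · simp at hj)
  rw [weightDiag_neg, ← hV] at h2
  refine ⟨_, mul_mem h1 hp, v, hv, hv', fun j => unitWeight l j + n j, _, mul_mem h2 hq, ?_⟩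
  rw [mul_assoc _ p v, ← hpv, weightDiag_add, hbKV, map_mul, map_mul]
  group

theorem unitWeight_mul_mem_prodSet (hm : 3 ≤ m) (i : Fin m) {g : GL (Fin m) T}
    (hg : g ∈ D.prodSet m) : weightDiag D.y (unitWeight i) * g ∈ D.prodSet m := by
  obtain ⟨_, ⟨p, hp, rfl⟩, u, hu, hu', n, q, hq, rfl⟩ := hg
  have h1 := weightDiag_conj_mul_inv_constPart_mem hm D.pos D.y D.pos_X.symm (unitWeight i)
    (unitWeight_le i) hp
  have h2 := D.mul_mem_prodSet h1 (D.unitWeight_const_mul_mem_prodSet hm i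
    (SpecialLinearGroup.map constantCoeff p) hu hu' n hq)
  convert h2 using 1
  have h3 : SpecialLinearGroup.map D.pos p =
      SpecialLinearGroup.map D.pos (p * (constPart p)⁻¹) *
        SpecialLinearGroup.map D.pos (constPart p) := by
    rw [← map_mul, inv_mul_cancel_right]
  rw [const_eq_pos, MonoidHom.comp_apply, h3, map_mul]
  group

theorem weightDiag_mul_mem_prodSet (hm : 3 ≤ m) (i : Fin m) (k : ℤ) {g : GL (Fin m) T}
    (hg : g ∈ D.prodSet m) : weightDiag D.y (fun j => k * unitWeight i j) * g ∈ D.prodSet m := by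
  let S : AddSubmonoid (Fin m → ℤ) :=
    { carrier := {n | ∀ g ∈ D.prodSet m, weightDiag D.y n * g ∈ D.prodSet m}
      zero_mem' := fun g hg => by
        have := weightDiag_zero (m := m) D.y
        rw [show (0 : Fin m → ℤ) = fun _ => 0 from rfl, this, one_mul]
        exact hg
      add_mem' := fun {n n'} hn hn' g hg => by
        rw [show n + n' = fun i => n i + n' i from rfl, weightDiag_add, mul_assoc]
        exact hn _ (hn' _ hg) }
  have hS : ∀ i, unitWeight i ∈ S := fun i g hg => D.unitWeight_mul_mem_prodSet hm i hg
  have hneg : -unitWeight i ∈ S := by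
    have h1 : (fun _ => -1) ∈ S := fun g hg => D.weightDiag_const_mul_mem_prodSet (-1) hg
    have h2 := S.add_mem h1 (S.sum_mem fun j (_ : j ∈ Finset.univ.erase i) => hS j)
    convert h2 using 1
    ext j
    simp only [Pi.neg_apply, Pi.add_apply, Finset.sum_apply, unitWeight_apply, Finset.sum_ite_eq,
      Finset.mem_erase, Finset.mem_univ, and_true]
    split_ifs <;> simp_all
  have hk : k • unitWeight i ∈ S := by
    obtain ⟨n, rfl | rfl⟩ := k.eq_nat_or_neg
    · rw [natCast_zsmul]
      exact S.nsmul_mem (hS i) n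
    · rw [neg_smul, natCast_zsmul, ← _root_.smul_neg]
      exact S.nsmul_mem hneg n
  exact hk g hg

theorem toGL_mem_prodSet (hm : 3 ≤ m)
    (hT : ∀ t, ∃ (k : ℕ) (f : A[X]), D.pos f = (D.y : T) ^ k * t)
    {g : SpecialLinearGroup (Fin m) T} (hg : g ∈ ElemSubgroup m T) :
    SpecialLinearGroup.toGL g ∈ D.prodSet m := by
  refine induction_left (C := fun g => SpecialLinearGroup.toGL g ∈ D.prodSet m) ?_ ?_ hg
  · exact ⟨1, one_mem _, 1, one_mem _, one_mem _, fun _ => 0, 1, one_mem _, by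
      simp [weightDiag_zero]⟩
  · intro g _ i j hij t h
    obtain ⟨k, f, hf⟩ := hT t
    have h1 : SpecialLinearGroup.toGL (SpecialLinearGroup.transvection hij t) =
        weightDiag D.y (fun l => (k : ℤ) * unitWeight j l) *
          SpecialLinearGroup.toGL (SpecialLinearGroup.map D.pos
            (SpecialLinearGroup.transvection hij f)) *
          weightDiag D.y (fun l => (-k : ℤ) * unitWeight j l) := by
      have : weightDiag D.y (fun l => (-k : ℤ) * unitWeight j l) =
          (weightDiag D.y (fun l => (k : ℤ) * unitWeight j l))⁻¹ := by
        rw [← weightDiag_neg]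
        simp
      rw [this, map_transvection, hf]
      refine Units.ext (Matrix.ext fun p q => ?_)
      rw [Units.val_mul, Units.val_mul, weightDiag_mul_mul_inv_apply]
      change transvection i j t p q = _ * transvection i j _ p q
      simp only [transvection, Matrix.add_apply, Matrix.one_apply, single_apply, unitWeight_apply]
      by_cases hpq : p = q
      · subst hpq
        have : ¬ (i = p ∧ j = p) := fun h => hij (h.1.trans h.2.symm)
        simp [this]
      · by_cases h' : i = p ∧ j = q
        · obtain ⟨rfl, rfl⟩ := h'
          simp only [hij, if_false, if_true, and_self, zero_add, mul_zero, mul_one, zero_sub,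
            _root_.zpow_neg, zpow_natCast, ← mul_assoc, ← Units.val_pow_eq_pow_val,
            ← Units.val_mul, inv_mul_cancel, Units.val_one, one_mul]
        · simp [hpq, h']
    rw [map_mul, h1, mul_assoc, mul_assoc]
    exact D.weightDiag_mul_mem_prodSet hm j _ (D.mul_mem_prodSet
      (toGL_map_mem_imageGL _ (transvection_mem hij f)) (D.weightDiag_mul_mem_prodSet hm j _ h))

end TwoCharts
end TwoCharts

section TwoCharts

open Polynomial

namespace TwoCharts

variable {m : ℕ} {A T F : Type*} [CommRing A] [IsLocalRing A] [CommRing T] [CommRing F]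
  (D : TwoCharts A T F)

theorem weightDiag_mul_apply (y : Tˣ) (n : Fin m → ℤ) (B : GL (Fin m) T) (i j : Fin m) :
    ((weightDiag y n * B : GL (Fin m) T) : Matrix (Fin m) (Fin m) T) i j =
      ↑(y ^ n i) * (B : Matrix (Fin m) (Fin m) T) i j := by
  rw [Units.val_mul, weightDiag, coe_diagUnits, diagonal_mul]

theorem det_weightDiag (y : Tˣ) (n : Fin m → ℤ) :
    ((weightDiag y n : GL (Fin m) T) : Matrix (Fin m) (Fin m) T).det = ↑(y ^ ∑ i, n i) := by
  rw [weightDiag, coe_diagUnits, det_diagonal, ← Units.coe_prod]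
  congr 1
  exact Finset.induction_on (motive := fun s => ∏ i ∈ s, y ^ n i = y ^ ∑ i ∈ s, n i) Finset.univ
    (by simp) fun i s hi h => by
      rw [Finset.prod_insert hi, Finset.sum_insert hi, h, _root_.zpow_add]

/-- A matrix over the first chart that agrees with one over the second chart up to an elementary
matrix is elementary. -/
theorem mem_of_map_pos_eq [Nontrivial F] (hm : 3 ≤ m)
    (hT : ∀ t, ∃ (k : ℕ) (f : A[X]), D.pos f = (D.y : T) ^ k * t)
    (h1 : ∀ k : ℤ, k < 0 → ∀ f g, D.red (D.pos f) = D.red (↑(D.y ^ k) * D.neg g) →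
      D.red (D.pos f) = 0)
    (h2 : ∀ f g, D.pos f = D.neg g → ∃ a, f = C a) (h3 : ∀ k : ℤ, D.y ^ k = 1 → k = 0)
    {h β : SpecialLinearGroup (Fin m) A[X]} {α : SpecialLinearGroup (Fin m) T}
    (hα : α ∈ ElemSubgroup m T)
    (heq : SpecialLinearGroup.map D.pos h = α * SpecialLinearGroup.map D.neg β) :
    h ∈ ElemSubgroup m A[X] := by
  obtain ⟨_, ⟨p, hp, rfl⟩, _, ⟨u, hu, rfl⟩, hu', n, _, ⟨q, hq, rfl⟩, hα'⟩ :=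
    D.toGL_mem_prodSet hm hT hα
  simp only [MonoidHom.comp_apply] at hα' hu'
  have key : SpecialLinearGroup.toGL (SpecialLinearGroup.map D.pos (p⁻¹ * h)) =
      SpecialLinearGroup.toGL (SpecialLinearGroup.map D.neg u) * (weightDiag D.y n *
        SpecialLinearGroup.toGL (SpecialLinearGroup.map D.neg (q * β))) := by
    have hE1 : SpecialLinearGroup.map D.pos (p⁻¹ * h) =
        (SpecialLinearGroup.map D.pos p)⁻¹ * (α * SpecialLinearGroup.map D.neg β) := by
      rw [map_mul, map_inv, heq]
    have hE2 : SpecialLinearGroup.map D.neg (q * β) =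
        SpecialLinearGroup.map D.neg q * SpecialLinearGroup.map D.neg β := by
      rw [map_mul]
    rw [hE1, hE2, map_mul, map_mul, map_mul, map_inv, hα']
    group
  have hred : ∀ i j, D.red (D.pos ((p⁻¹ * h : SpecialLinearGroup (Fin m) A[X]) i j)) =
      D.red (↑(D.y ^ n i) * D.neg ((q * β : SpecialLinearGroup (Fin m) A[X]) i j)) := by
    intro i j
    have hk := (congrArg (GeneralLinearGroup.map D.red) key).trans
      ((GeneralLinearGroup.map D.red).map_mul _ _)
    rw [(show GeneralLinearGroup.map D.red (SpecialLinearGroup.toGL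
      (SpecialLinearGroup.map D.neg u)) = 1 from hu'), one_mul] at hk
    have := congrArg (fun B : GL (Fin m) F => (B : Matrix (Fin m) (Fin m) F) i j) hk
    simp only [GeneralLinearGroup.map_apply, weightDiag_mul_apply] at this
    exact this
  have hn0 : ∀ i, 0 ≤ n i := by
    intro i
    by_contra! hi
    have hrow : ∀ j, (SpecialLinearGroup.map (D.red.comp D.pos) (p⁻¹ * h)) i j = 0 := fun j =>
      h1 _ hi _ _ (hred i j)
    have hdet := det_eq_zero_of_row_eq_zero i hrow
    rw [Matrix.SpecialLinearGroup.det_coe] at hdet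
    exact one_ne_zero hdet
  have hsum : ∑ i, n i = 0 := by
    refine h3 _ (Units.ext ?_)
    have hk := congrArg (fun B : GL (Fin m) T => (B : Matrix (Fin m) (Fin m) T).det) key
    simp only [Units.val_mul, det_mul, Matrix.SpecialLinearGroup.coe_GL_coe_matrix,
      Matrix.SpecialLinearGroup.det_coe, det_weightDiag, one_mul, mul_one] at hk
    exact hk.symm
  have hn : n = fun _ => 0 :=
    funext fun i => (Finset.sum_eq_zero_iff_of_nonneg fun i _ => hn0 i).1 hsum i (Finset.mem_univ i)
  rw [hn, weightDiag_zero, one_mul, ← map_mul, ← map_mul] at key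
  have key' := Matrix.SpecialLinearGroup.toGL_injective key
  have hconst : p⁻¹ * h = constPart (p⁻¹ * h) := by
    ext1 i j
    obtain ⟨a, ha⟩ := h2 _ _ (congrArg (fun B : SpecialLinearGroup (Fin m) T => B i j) key')
    change _ = C (constantCoeff ((p⁻¹ * h : SpecialLinearGroup (Fin m) A[X]) i j))
    rw [ha, constantCoeff_apply, coeff_C_zero]
  have hmem : p⁻¹ * h ∈ ElemSubgroup m A[X] := by
    rw [hconst]
    exact map_mem _ (mem_of_isLocalRing _)
  simpa using mul_mem hp hmem

end TwoCharts

open LaurentPolynomial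

variable {A : Type*} [CommRing A]

/-- The coordinate of the Laurent polynomial ring, as a unit. -/
noncomputable def laurentUnit (A : Type*) [CommRing A] : (A[T;T⁻¹])ˣ where
  val := T 1
  inv := T (-1)
  val_inv := by rw [← T_add]; simp
  inv_val := by rw [← T_add]; simp

theorem coe_laurentUnit_zpow (k : ℤ) : ((laurentUnit A ^ k : (A[T;T⁻¹])ˣ) : A[T;T⁻¹]) = T k := by
  have hn : ∀ n : ℕ, ((laurentUnit A ^ n : (A[T;T⁻¹])ˣ) : A[T;T⁻¹]) = T n := by
    intro n
    rw [Units.val_pow_eq_pow_val, laurentUnit, T_pow, mul_one]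
  obtain ⟨n, rfl | rfl⟩ := k.eq_nat_or_neg
  · rw [zpow_natCast, hn]
  · rw [_root_.zpow_neg, zpow_natCast, Units.inv_eq_of_mul_eq_one_right]
    rw [hn, ← T_add]
    simp

/-- The inclusion of polynomials in the inverse of the variable into Laurent polynomials. -/
noncomputable def toLaurentInv (A : Type*) [CommRing A] : A[X] →+* A[T;T⁻¹] :=
  (invert (R := A)).toRingEquiv.toRingHom.comp toLaurent

theorem toLaurentInv_apply (f : A[X]) : toLaurentInv A f = invert (toLaurent f) := rfl

theorem coeff_toLaurent_natCast (f : A[X]) (n : ℕ) : (toLaurent f).coeff n = f.coeff n := by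
  rw [coeff_toLaurent]
  exact Finsupp.mapDomain_apply Nat.cast_injective _ _

theorem coeff_toLaurent_of_neg (f : A[X]) {k : ℤ} (hk : k < 0) : (toLaurent f).coeff k = 0 := by
  rw [coeff_toLaurent]
  refine Finsupp.mapDomain_of_notMem_range _ _ ?_
  rintro ⟨n, rfl⟩
  simp at hk
  lia

theorem coeff_T_mul (f : A[T;T⁻¹]) (k n : ℤ) : (T k * f).coeff (k + n) = f.coeff n := by
  rw [T_mul, add_comm, T, AddMonoidAlgebra.coeff_mul_single_add, mul_one]

theorem coeff_eq_zero_of_toLaurent_eq {f g : A[X]} {k : ℤ}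
    (h : toLaurent f = T k * toLaurentInv A g) (n : ℕ) (hn : k < n) : f.coeff n = 0 := by
  rw [← coeff_toLaurent_natCast, h, show (n : ℤ) = k + (n - k) by ring, coeff_T_mul,
    toLaurentInv_apply, invert_apply, coeff_toLaurent_of_neg _ (by lia)]

/-- The reduction map of Laurent polynomials over a local ring. -/
noncomputable def laurentResidue (A : Type*) [CommRing A] [IsLocalRing A] :
    A[T;T⁻¹] →+* (IsLocalRing.ResidueField A)[T;T⁻¹] :=
  AddMonoidAlgebra.mapRingHom ℤ (IsLocalRing.residue A)

theorem laurentResidue_T [IsLocalRing A] (k : ℤ) : laurentResidue A (T k) = T k := by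
  rw [laurentResidue, T, AddMonoidAlgebra.mapRingHom_single, map_one, T]

theorem laurentResidue_toLaurent [IsLocalRing A] (f : A[X]) :
    laurentResidue A (toLaurent f) = toLaurent (f.map (IsLocalRing.residue A)) := by
  have : (laurentResidue A).comp toLaurent =
      (toLaurent (R := IsLocalRing.ResidueField A)).comp (mapRingHom (IsLocalRing.residue A)) := by
    refine ringHom_ext (fun a => ?_) ?_
    · simp only [RingHom.comp_apply, toLaurent_C, coe_mapRingHom, map_C, laurentResidue]
      rw [← single_eq_C, AddMonoidAlgebra.mapRingHom_single, single_eq_C]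
    · simp only [RingHom.comp_apply, toLaurent_X, coe_mapRingHom, map_X, laurentResidue_T]
  exact congrArg (fun f' => f' f) this

theorem laurentResidue_invert [IsLocalRing A] (f : A[T;T⁻¹]) :
    laurentResidue A (invert f) = invert (laurentResidue A f) := by
  refine LaurentPolynomial.ext fun n => ?_
  rw [laurentResidue, AddMonoidAlgebra.coeff_mapRingHom, invert_apply, invert_apply,
    AddMonoidAlgebra.coeff_mapRingHom]

/-- The two standard charts of the projective line over a local ring. -/
noncomputable def laurentCharts (A : Type*) [CommRing A] [IsLocalRing A] :
    TwoCharts A A[T;T⁻¹] (IsLocalRing.ResidueField A)[T;T⁻¹] where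
  pos := toLaurent
  neg := toLaurentInv A
  y := laurentUnit A
  red := laurentResidue A
  neg_C a := by rw [toLaurentInv_apply, toLaurent_C, invert_C]
  pos_X := toLaurent_X
  neg_X := by
    rw [toLaurentInv_apply, toLaurent_X, invert_T, ← _root_.zpow_neg_one, coe_laurentUnit_zpow]
  red_pos_C a ha := by
    rw [laurentResidue_toLaurent, map_C, (IsLocalRing.residue_eq_zero_iff a).2 ha]
    simp
  constantCoeff_mem p hp := by
    rw [toLaurentInv_apply, laurentResidue_invert, laurentResidue_toLaurent,
      EmbeddingLike.map_eq_zero_iff, toLaurent_eq_zero] at hp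
    rw [← IsLocalRing.residue_eq_zero_iff, constantCoeff_apply, ← coeff_map, hp, coeff_zero]

theorem mem_of_toLaurent_eq [IsLocalRing A] {m : ℕ} (hm : 3 ≤ m)
    {h β : SpecialLinearGroup (Fin m) A[X]} {α : SpecialLinearGroup (Fin m) A[T;T⁻¹]}
    (hα : α ∈ ElemSubgroup m A[T;T⁻¹])
    (heq : SpecialLinearGroup.map toLaurent h = α * SpecialLinearGroup.map (toLaurentInv A) β) :
    h ∈ ElemSubgroup m A[X] := by
  refine (laurentCharts A).mem_of_map_pos_eq hm ?_ ?_ ?_ ?_ hα heq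
  · intro t
    obtain ⟨k, f, hf⟩ := exists_T_pow t
    refine ⟨k, f, ?_⟩
    change toLaurent f = T 1 ^ k * t
    rw [hf, T_pow, mul_one, T_mul]
  · intro k hk f g hfg
    change laurentResidue A (toLaurent f) =
      laurentResidue A (↑(laurentUnit A ^ k) * toLaurentInv A g) at hfg
    change laurentResidue A (toLaurent f) = 0
    rw [coe_laurentUnit_zpow, map_mul, laurentResidue_T, toLaurentInv_apply, laurentResidue_invert,
      laurentResidue_toLaurent, laurentResidue_toLaurent] at hfg
    rw [laurentResidue_toLaurent, toLaurent_eq_zero]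
    ext n
    exact coeff_eq_zero_of_toLaurent_eq hfg n (by lia)
  · intro f g hfg
    refine ⟨f.coeff 0, ?_⟩
    ext n
    rw [coeff_C]
    split_ifs with hn
    · rw [hn]
    · exact coeff_eq_zero_of_toLaurent_eq (k := 0) (g := g) (by rw [T_zero, one_mul]; exact hfg) n
        (by lia)
  · intro k hk
    by_contra hk0
    have := congrArg (fun x : (A[T;T⁻¹])ˣ => (x : A[T;T⁻¹]).coeff 0) hk
    change ((laurentUnit A ^ k : (A[T;T⁻¹])ˣ) : A[T;T⁻¹]).coeff 0 = (1 : A[T;T⁻¹]).coeff 0 at this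
    rw [coe_laurentUnit_zpow, T_apply, if_neg hk0, ← T_zero, T_apply, if_pos rfl] at this
    exact zero_ne_one this

end TwoCharts

section LocalGlobal

open Polynomial

variable {m : ℕ} {R S T : Type*} [CommRing R] [CommRing S] [CommRing T]

theorem exists_scale_mul_inv_constPart_mem (hm : 3 ≤ m) (M : Submonoid R) [Algebra R T]
    [IsLocalization M T] {ε : SpecialLinearGroup (Fin m) T[X]} (hε : ε ∈ ElemSubgroup m T[X]) :
    ∃ s ∈ M, ∀ c : R, SpecialLinearGroup.map (compRingHom (C (algebraMap R T (s * c)) * X))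
      (ε * (constPart ε)⁻¹) ∈
        (ElemSubgroup m R[X]).map (SpecialLinearGroup.map (mapRingHom (algebraMap R T))) := by
  let _ : Algebra R[X] T[X] := Polynomial.algebra R T
  have : IsLocalization (M.map (C : R →+* R[X])) T[X] := Polynomial.isLocalization M T
  have halg : ∀ f : R[X], algebraMap R[X] T[X] f = mapRingHom (algebraMap R T) f := fun _ => rfl
  refine induction_right (C := fun ε => ∃ s ∈ M, ∀ c : R,
    SpecialLinearGroup.map (compRingHom (C (algebraMap R T (s * c)) * X)) (ε * (constPart ε)⁻¹) ∈
      (ElemSubgroup m R[X]).map (SpecialLinearGroup.map (mapRingHom (algebraMap R T)))) ?_ ?_ hε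
  · refine ⟨1, one_mem _, fun c => ?_⟩
    simp only [constPart, map_one, mul_one, inv_one, one_mem]
  · rintro g hg i j hij a ⟨s₁, hs₁, h₁⟩
    obtain ⟨_, ⟨s₂, hs₂, rfl⟩, h₂⟩ :=
      exists_conj_transvection_mem (T := T[X]) hm (M.map (C : R →+* R[X])) (constPart g)
    obtain ⟨_, ⟨d, hd, rfl⟩, hb⟩ := exists_common_denom (T := T[X]) (M.map (C : R →+* R[X]))
      (fun _ : Unit => a.divX)
    obtain ⟨b, hb⟩ := hb ()
    refine ⟨s₁ * (s₂ * d), mul_mem hs₁ (mul_mem hs₂ hd), fun c => ?_⟩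
    rw [mul_transvection_mul_inv_constPart, map_mul]
    refine mul_mem ?_ ?_
    · rw [mul_assoc]
      exact h₁ _
    · set t : R := s₁ * (s₂ * d) * c with ht
      have hconst : SpecialLinearGroup.map (compRingHom (C (algebraMap R T t) * X)) (constPart g) =
          constPart g := by
        rw [constPart, map_map]
        congr 2
        ext x
        simp
      have hE : ∀ f : R[X], (mapRingHom (algebraMap R T) f).comp (C (algebraMap R T t) * X) =
          mapRingHom (algebraMap R T) (f.comp (C t * X)) := fun f => by
        simp [map_comp]
      have hx : (X * a.divX).comp (C (algebraMap R T t) * X) = algebraMap R[X] T[X]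
          (C s₂ * (C (s₁ * c) * X * b.comp (C t * X))) := by
        have := congrArg (fun f : T[X] => f.comp (C (algebraMap R T t) * X)) hb
        simp only [halg, hE] at this
        rw [mul_comp, hE] at this
        rw [halg, map_mul (mapRingHom (algebraMap R T)), map_mul (mapRingHom (algebraMap R T)),
          ← this, mul_comp, X_comp]
        generalize a.divX.comp (C (algebraMap R T t) * X) = q
        simp only [map_mul, coe_mapRingHom, map_C, map_X, C_comp, ht]
        ring
      rw [map_mul, map_mul, map_inv, hconst, map_transvection, coe_compRingHom_apply, hx]
      exact h₂ _ i j hij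
 
/-- The substitution `X ↦ X + s Y`, with `Y` the outer variable. -/
noncomputable def shift (s : R[X]) : R[X] →+* R[X][X] :=
  eval₂RingHom (C.comp C) (C X + C s * X)

theorem shift_C (s : R[X]) (a : R) : shift s (C a) = C (C a) := by
  simp [shift]

theorem shift_X (s : R[X]) : shift s X = C X + C s * X := by
  simp [shift]

/-- The increment `h(X + s Y) h(X)⁻¹`. -/
noncomputable def increment (h : SpecialLinearGroup (Fin m) R[X]) (s : R[X]) :
    SpecialLinearGroup (Fin m) R[X][X] :=
  SpecialLinearGroup.map (shift s) h * (SpecialLinearGroup.map C h)⁻¹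

theorem map_increment {h : SpecialLinearGroup (Fin m) R[X]} {s t : R[X]} (f : R[X][X] →+* R[X][X])
    (hf : f.comp C = C) (hX : f (X) = C t * X) :
    SpecialLinearGroup.map f (increment h s) = increment h (s * t) := by
  have h1 : f.comp (shift s) = shift (s * t) := by
    have hC : ∀ x, f (C x) = C x := fun x => RingHom.congr_fun hf x
    ext x
    · simp [shift_C, hC]
    · simp [shift_X, hC, hX, mul_assoc]
  rw [increment, map_mul, map_inv, map_map, map_map, h1, hf, increment]

/-- The increments of `h` in elementary directions. -/
noncomputable def incrementIdeal (h : SpecialLinearGroup (Fin m) R[X]) : Ideal R where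
  carrier := {s | increment h (C s) ∈ ElemSubgroup m R[X][X]}
  zero_mem' := by
    have : shift (0 : R[X]) = C := by
      ext x
      · simp [shift_C]
      · simp [shift_X]
    rw [Set.mem_ofPred_eq, map_zero, increment, this, mul_inv_cancel]
    exact one_mem _
  smul_mem' b s hs := by
    have := map_mem (compRingHom (C (C b) * X)) hs
    rw [map_increment (t := C b)] at this
    · rwa [smul_eq_mul, mul_comm, Set.mem_ofPred_eq, C_mul]
    · ext x <;> simp
    · simp
  add_mem' {s t} hs ht := by
    have hσ : (eval₂RingHom (shift (C t)) X).comp (shift (C s)) = shift (C (s + t)) := by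
      refine ringHom_ext (fun x => ?_) ?_
      · simp [shift_C]
      · simp only [RingHom.comp_apply, shift_X, shift_C, map_add, map_mul, coe_eval₂RingHom,
          eval₂_C, eval₂_X]
        ring
    have hσ' : (eval₂RingHom (shift (C t)) X).comp C = shift (C t) := by
      ext x <;> simp
    have := mul_mem (map_mem (eval₂RingHom (shift (C t)) X) hs) ht
    rwa [increment, map_mul, map_inv, map_map, map_map, hσ, hσ', increment, mul_assoc,
      inv_mul_cancel_left] at this

theorem mem_incrementIdeal {h : SpecialLinearGroup (Fin m) R[X]} {s : R} :
    s ∈ incrementIdeal h ↔ increment h (C s) ∈ ElemSubgroup m R[X][X] :=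
  Iff.rfl

theorem mul_inv_constPart_mem_of_increment_one (h : SpecialLinearGroup (Fin m) R[X])
    (h1 : increment h 1 ∈ ElemSubgroup m R[X][X]) :
    h * (constPart h)⁻¹ ∈ ElemSubgroup m R[X] := by
  have := map_mem (eval₂RingHom (C.comp constantCoeff) X) h1
  have hs : (eval₂RingHom (C.comp constantCoeff) X).comp (shift (1 : R[X])) = RingHom.id _ := by
    refine ringHom_ext (fun x => ?_) ?_
    · simp [shift_C]
    · simp [shift_X]
  have hC : (eval₂RingHom (C.comp constantCoeff) X).comp C =
      (C : R →+* R[X]).comp constantCoeff := by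
    refine ringHom_ext (fun x => ?_) ?_ <;> simp
  rwa [increment, map_mul, map_inv, map_map, map_map, hs, hC, map_id, ← map_map] at this

theorem constPart_increment (h : SpecialLinearGroup (Fin m) R[X]) (s : R[X]) :
    constPart (increment h s) = 1 := by
  have hs : constantCoeff.comp (shift s) = RingHom.id _ := by
    refine ringHom_ext (fun x => ?_) ?_
    · simp [shift_C]
    · simp [shift_X]
  have hC : (constantCoeff (R := R[X])).comp C = RingHom.id _ := by
    ext x <;> simp
  have h1 : SpecialLinearGroup.map constantCoeff (increment h s) = 1 := by
    rw [increment, map_mul, map_inv, map_map, map_map, hs, hC, mul_inv_cancel]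
  rw [constPart, h1, map_one]

theorem map_map_increment (f : R →+* T) (h : SpecialLinearGroup (Fin m) R[X]) (s : R[X]) :
    SpecialLinearGroup.map (mapRingHom (mapRingHom f)) (increment h s) =
      increment (SpecialLinearGroup.map (mapRingHom f) h) (mapRingHom f s) := by
  have hs : (mapRingHom (mapRingHom f)).comp (shift s) =
      (shift (mapRingHom f s)).comp (mapRingHom f) := by
    refine ringHom_ext (fun x => ?_) ?_
    · simp [shift_C]
    · simp [shift_X]
  have hC : (mapRingHom (mapRingHom f)).comp C = (C : T[X] →+* T[X][X]).comp (mapRingHom f) := by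
    refine ringHom_ext (fun x => ?_) ?_ <;> simp
  rw [increment, increment, map_mul, map_inv, map_map, map_map, map_map, map_map, hs, hC]

/-- Quillen-Suslin local-global principle for elementary matrices over a domain. -/
theorem mul_inv_constPart_mem_of_localization [IsDomain R] (hm : 3 ≤ m)
    (h : SpecialLinearGroup (Fin m) R[X])
    (hloc : ∀ (P : Ideal R) [P.IsMaximal], SpecialLinearGroup.map
      (mapRingHom (algebraMap R (Localization.AtPrime P))) h ∈
        ElemSubgroup m (Localization.AtPrime P)[X]) :
    h * (constPart h)⁻¹ ∈ ElemSubgroup m R[X] := by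
  suffices hQ : incrementIdeal h = ⊤ by
    refine mul_inv_constPart_mem_of_increment_one h ?_
    have h1 : (1 : R) ∈ incrementIdeal h := hQ ▸ Submodule.mem_top
    rw [← C_1]
    exact mem_incrementIdeal.1 h1
  by_contra hQ
  obtain ⟨P, hP, hle⟩ := Ideal.exists_le_maximal _ hQ
  set T := Localization.AtPrime P
  set f : R →+* T := algebraMap R T
  have hf : Function.Injective f :=
    IsLocalization.injective T P.primeCompl_le_nonZeroDivisors
  let _ : Algebra R[X] T[X] := Polynomial.algebra R T
  have : IsLocalization (P.primeCompl.map (C : R →+* R[X])) T[X] :=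
    Polynomial.isLocalization P.primeCompl T
  have hε : increment (SpecialLinearGroup.map (mapRingHom f) h) 1 ∈ ElemSubgroup m T[X][X] :=
    mul_mem (map_mem _ (hloc P)) (inv_mem (map_mem _ (hloc P)))
  obtain ⟨_, ⟨s, hs, rfl⟩, hE⟩ := exists_scale_mul_inv_constPart_mem hm
    (P.primeCompl.map (C : R →+* R[X])) hε
  refine hs (hle ?_)
  have hE1 := hE 1
  rw [constPart_increment, inv_one, mul_one, mul_one, map_increment (t := mapRingHom f (C s)),
    one_mul, ← map_map_increment] at hE1
  · obtain ⟨e, he, heq⟩ := hE1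
    have hinj : Function.Injective (mapRingHom (mapRingHom f)) :=
      Polynomial.map_injective _ (Polynomial.map_injective _ hf)
    exact mem_incrementIdeal.2 (ElemSubgroup.map_injective hinj heq ▸ he)
  · ext x <;> simp
  · simp
    rfl

end LocalGlobal

section Density

variable {m : ℕ} {R S T : Type*} [CommRing R] [CommRing S] [CommRing T]

theorem exists_map_eq {f : R →+* S} (hf : Function.Injective f)
    (g : SpecialLinearGroup (Fin m) S) (hg : ∀ i j, ∃ a, f a = g i j) :
    ∃ h, SpecialLinearGroup.map f h = g := by
  choose A hA using hg
  have hmap : f.mapMatrix (Matrix.of A) = g := by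
    ext i j
    simp [hA]
  refine ⟨⟨Matrix.of A, hf ?_⟩, Subtype.ext hmap⟩
  rw [RingHom.map_det, hmap, Matrix.SpecialLinearGroup.det_coe, map_one]

theorem exists_eq_mul_of_dense (hm : 3 ≤ m) (M : Submonoid R) [Algebra R T] [IsLocalization M T]
    (f : S →+* T) (hf : ∀ x ∈ M, ∀ t, ∃ s r, t = f s + algebraMap R T (x * r))
    {e : SpecialLinearGroup (Fin m) T} (he : e ∈ ElemSubgroup m T) :
    ∃ α ∈ ElemSubgroup m S, ∃ β ∈ ElemSubgroup m R,
      e = SpecialLinearGroup.map f α * SpecialLinearGroup.map (algebraMap R T) β := by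
  refine induction_left (C := fun e => ∃ α ∈ ElemSubgroup m S, ∃ β ∈ ElemSubgroup m R,
      e = SpecialLinearGroup.map f α * SpecialLinearGroup.map (algebraMap R T) β) ?_ ?_ he
  · exact ⟨1, one_mem _, 1, one_mem _, by rw [map_one, map_one, one_mul]⟩
  · rintro _ - i j hij a ⟨α, hα, β, hβ, rfl⟩
    obtain ⟨x, hx, h⟩ := exists_conj_transvection_mem hm M (SpecialLinearGroup.map f α)⁻¹
    obtain ⟨s, r, rfl⟩ := hf x hx a
    obtain ⟨β', hβ', h'⟩ := h r i j hij
    refine ⟨SpecialLinearGroup.transvection hij s * α, mul_mem (transvection_mem hij s) hα,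
      β' * β, mul_mem hβ' hβ, ?_⟩
    rw [transvection_mul_transvection, map_mul (SpecialLinearGroup.map f), map_transvection,
      map_mul (SpecialLinearGroup.map (algebraMap R T)), h']
    group

end Density

section LaurentSeries

open Polynomial LaurentPolynomial PowerSeries LaurentSeries

variable {m : ℕ} (B : Type*) [CommRing B]

/-- The variable of the ring of Laurent series, as a unit. -/
noncomputable def seriesUnit : (LaurentSeries B)ˣ where
  val := HahnSeries.single 1 1
  inv := HahnSeries.single (-1) 1
  val_inv := by simp
  inv_val := by simp

/-- The inclusion of Laurent polynomials in Laurent series. -/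
noncomputable def toSeries : B[T;T⁻¹] →+* LaurentSeries B :=
  LaurentPolynomial.eval₂ HahnSeries.C (seriesUnit B)

variable {B}

theorem algebraMap_powerSeries_X :
    algebraMap (PowerSeries B) (LaurentSeries B) PowerSeries.X = seriesUnit B :=
  HahnSeries.ofPowerSeries_X

theorem toSeries_toLaurent (f : B[X]) :
    toSeries B (toLaurent f) = algebraMap (PowerSeries B) (LaurentSeries B) f := by
  have : (toSeries B).comp toLaurent = (algebraMap (PowerSeries B) (LaurentSeries B)).comp
      Polynomial.coeToPowerSeries.ringHom := by
    refine Polynomial.ringHom_ext (fun a => ?_) ?_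
    · simp [toSeries]
    · simp [toSeries, seriesUnit]
  exact RingHom.congr_fun this f

theorem toSeries_T (n : ℤ) : toSeries B (T n) = ↑(seriesUnit B ^ n) := by
  rw [toSeries, LaurentPolynomial.eval₂_T]

theorem exists_toSeries_add (N : ℕ) (t : LaurentSeries B) :
    ∃ s r, t = toSeries B s +
      algebraMap (PowerSeries B) (LaurentSeries B) (PowerSeries.X ^ N * r) := by
  obtain ⟨⟨f, ⟨_, k, rfl⟩⟩, hf⟩ := IsLocalization.surj (Submonoid.powers (PowerSeries.X (R := B))) t
  have hdvd : PowerSeries.X ^ (N + k) ∣ f - ((f.trunc (N + k) : B[X]) : PowerSeries B) := by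
    rw [PowerSeries.X_pow_dvd_iff]
    intro i hi
    rw [map_sub, Polynomial.coeff_coe, PowerSeries.coeff_trunc, if_pos hi, sub_self]
  obtain ⟨r, hr⟩ := hdvd
  generalize f.trunc (N + k) = q at hr
  rw [sub_eq_iff_eq_add] at hr
  subst hr
  refine ⟨T (-k) * toLaurent q, r, ?_⟩
  simp only [map_add, map_mul, map_pow, algebraMap_powerSeries_X] at hf
  rw [map_mul, toSeries_T, toSeries_toLaurent, map_mul, map_pow, algebraMap_powerSeries_X,
    ← (seriesUnit B ^ k).isUnit.mul_left_inj]
  simp only [Units.val_pow_eq_pow_val]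
  rw [hf, _root_.zpow_neg, zpow_natCast]
  have : (↑(seriesUnit B ^ k)⁻¹ : LaurentSeries B) * (seriesUnit B : LaurentSeries B) ^ k = 1 := by
    rw [← Units.val_pow_eq_pow_val, Units.inv_mul]
  linear_combination - algebraMap (PowerSeries B) (LaurentSeries B) q * this

theorem exists_polynomial_eq {l : B[T;T⁻¹]} {f : PowerSeries B}
    (h : toSeries B l = algebraMap (PowerSeries B) (LaurentSeries B) f) :
    ∃ q : B[X], toLaurent q = l ∧ (q : PowerSeries B) = f := by
  obtain ⟨n, p, hp⟩ := LaurentPolynomial.exists_T_pow l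
  have h1 : (p : PowerSeries B) = PowerSeries.X ^ n * f := by
    apply HahnSeries.ofPowerSeries_injective (Γ := ℤ) (R := B)
    have := congrArg (toSeries B) hp
    rw [toSeries_toLaurent, map_mul, h, toSeries_T, zpow_natCast, Units.val_pow_eq_pow_val,
      ← algebraMap_powerSeries_X, ← map_pow, mul_comm, ← map_mul] at this
    exact this
  have h2 : Polynomial.X ^ n ∣ p := by
    rw [Polynomial.X_pow_dvd_iff]
    intro i hi
    rw [← Polynomial.coeff_coe, h1]
    exact PowerSeries.X_pow_dvd_iff.1 (dvd_mul_right _ _) i hi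
  obtain ⟨q, rfl⟩ := h2
  refine ⟨q, ?_, ?_⟩
  · rw [map_mul, map_pow, toLaurent_X, T_pow, mul_comm, mul_one] at hp
    exact (isUnit_T (n : ℤ)).mul_left_inj.1 hp
  · rw [Polynomial.coe_mul, Polynomial.coe_pow, Polynomial.coe_X] at h1
    exact PowerSeries.X_pow_mul_cancel h1

/-- A matrix of Laurent polynomials that is elementary over Laurent series is, up to an elementary
factor, a matrix of polynomials with elementary constant part. -/
theorem exists_eq_mul_toLaurent (hm : 3 ≤ m) {g : SpecialLinearGroup (Fin m) B[T;T⁻¹]}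
    (hg : SpecialLinearGroup.map (toSeries B) g ∈ ElemSubgroup m (LaurentSeries B)) :
    ∃ α ∈ ElemSubgroup m B[T;T⁻¹], ∃ h : SpecialLinearGroup (Fin m) B[X],
      g = α * SpecialLinearGroup.map toLaurent h ∧
        SpecialLinearGroup.map Polynomial.constantCoeff h ∈ ElemSubgroup m B := by
  obtain ⟨α, hα, β, hβ, hgαβ⟩ := exists_eq_mul_of_dense hm
    (Submonoid.powers (PowerSeries.X (R := B))) (toSeries B)
    (by rintro _ ⟨N, rfl⟩ t; exact exists_toSeries_add N t) hg
  have hl : SpecialLinearGroup.map (toSeries B) (α⁻¹ * g) =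
      SpecialLinearGroup.map (algebraMap (PowerSeries B) (LaurentSeries B)) β := by
    rw [map_mul, map_inv, hgαβ, inv_mul_cancel_left]
  generalize hγ : α⁻¹ * g = γ at hl
  have hq : ∀ i j, ∃ q : B[X], toLaurent q = γ i j ∧ (q : PowerSeries B) = β i j := fun i j =>
    exists_polynomial_eq
      (congrArg (fun x : SpecialLinearGroup (Fin m) (LaurentSeries B) => x i j) hl)
  obtain ⟨h, rfl⟩ := exists_map_eq toLaurent_injective γ fun i j => (hq i j).imp fun _ => And.left
  refine ⟨α, hα, h, by rw [← hγ, mul_inv_cancel_left], ?_⟩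
  convert map_mem (PowerSeries.constantCoeff (R := B)) hβ using 1
  ext i j
  obtain ⟨q, hq1, hq2⟩ := hq i j
  have : q = h i j := toLaurent_injective hq1
  simp [← hq2, this]

end LaurentSeries

section LaurentDescent

open Polynomial LaurentPolynomial

variable {m : ℕ} {A B : Type*} [CommRing A] [CommRing B]

/-- The map of Laurent polynomial rings induced by a map of the coefficients. -/
noncomputable def laurentMap (f : B →+* A) : B[T;T⁻¹] →+* A[T;T⁻¹] :=
  LaurentPolynomial.eval₂ (LaurentPolynomial.C.comp f) (laurentUnit A)

theorem laurentMap_toLaurent (f : B →+* A) :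
    (laurentMap f).comp toLaurent = toLaurent.comp (mapRingHom f) := by
  refine Polynomial.ringHom_ext (fun a => ?_) ?_
  · simp [laurentMap, -LaurentPolynomial.single_eq_C_mul_T]
  · have := coe_laurentUnit_zpow (A := A) 1
    rw [zpow_one] at this
    simp [laurentMap, this]

theorem laurentMap_toLaurentInv (f : B →+* A) :
    (laurentMap f).comp (toLaurentInv B) = (toLaurentInv A).comp (mapRingHom f) := by
  refine Polynomial.ringHom_ext (fun a => ?_) ?_
  · simp [laurentMap, toLaurentInv_apply]
  · simp only [RingHom.comp_apply, toLaurentInv_apply, laurentMap, toLaurent_X, invert_T,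
      coe_mapRingHom, map_X]
    rw [LaurentPolynomial.eval₂_T, coe_laurentUnit_zpow]

/-- The automorphism of the ring of Laurent polynomials that inverts the variable. -/
noncomputable def invertHom (B : Type*) [CommRing B] : B[T;T⁻¹] →+* B[T;T⁻¹] :=
  (invert : B[T;T⁻¹] ≃ₐ[B] B[T;T⁻¹]).toRingEquiv.toRingHom

theorem invertHom_comp_invertHom : (invertHom B).comp (invertHom B) = RingHom.id _ :=
  RingHom.ext fun f => involutive_invert f

theorem invertHom_comp_toLaurent : (invertHom B).comp toLaurent = toLaurentInv B :=
  rfl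

/-- A matrix of Laurent polynomials is elementary if it is elementary over the Laurent series at
zero and at infinity. -/
theorem mem_of_toSeries_mem [IsDomain B] (hm : 3 ≤ m) {g : SpecialLinearGroup (Fin m) B[T;T⁻¹]}
    (h0 : SpecialLinearGroup.map (toSeries B) g ∈ ElemSubgroup m (LaurentSeries B))
    (h1 : SpecialLinearGroup.map ((toSeries B).comp (invertHom B)) g ∈
      ElemSubgroup m (LaurentSeries B)) :
    g ∈ ElemSubgroup m B[T;T⁻¹] := by
  obtain ⟨α, hα, h, rfl, hh⟩ := exists_eq_mul_toLaurent hm h0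
  refine mul_mem hα (map_mem _ ?_)
  have h2 : SpecialLinearGroup.map (toSeries B) (SpecialLinearGroup.map (invertHom B)
      (SpecialLinearGroup.map toLaurent h)) ∈ ElemSubgroup m (LaurentSeries B) := by
    rw [map_mul, ← map_map] at h1
    rw [map_map]
    exact ((ElemSubgroup m _).mul_mem_cancel_left (map_mem _ (map_mem _ hα))).1 h1
  obtain ⟨α', hα', β, hβ, -⟩ := exists_eq_mul_toLaurent hm h2
  have heq : SpecialLinearGroup.map toLaurent h = SpecialLinearGroup.map (invertHom B) α' *
      SpecialLinearGroup.map (toLaurentInv B) β := by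
    have := congrArg (SpecialLinearGroup.map (invertHom B)) hβ
    rwa [map_map, invertHom_comp_invertHom, map_id, map_mul, map_map,
      invertHom_comp_toLaurent] at this
  have hloc : h * (constPart h)⁻¹ ∈ ElemSubgroup m B[X] := by
    refine mul_inv_constPart_mem_of_localization hm h fun P _ => ?_
    set f := algebraMap B (Localization.AtPrime P)
    refine mem_of_toLaurent_eq hm (map_mem (laurentMap f) (map_mem (invertHom B) hα'))
      (β := SpecialLinearGroup.map (mapRingHom f) β) ?_
    have := congrArg (SpecialLinearGroup.map (laurentMap f)) heq
    rwa [map_mul, map_map, map_map (toLaurentInv B), laurentMap_toLaurent,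
      laurentMap_toLaurentInv,
      ← map_map, ← map_map (mapRingHom f)] at this
  rw [← inv_mul_cancel_right h (constPart h)]
  exact mul_mem hloc (map_mem _ hh)

end LaurentDescent

section FractionCoefficients

open Polynomial LaurentPolynomial

theorem laurent_ringHom_ext {R S : Type*} [CommRing R] [CommRing S] {f g : R[T;T⁻¹] →+* S}
    (hC : ∀ a, f (LaurentPolynomial.C a) = g (LaurentPolynomial.C a))
    (hT : f (T 1) = g (T 1)) : f = g := by
  have hp : f.comp toLaurent = g.comp toLaurent :=
    Polynomial.ringHom_ext (by simpa using hC) (by simpa using hT)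
  refine RingHom.ext fun l => ?_
  obtain ⟨n, p, hp'⟩ := LaurentPolynomial.exists_T_pow l
  have hn : g (T n) = f (T n) := by
    have hpow : (T n : R[T;T⁻¹]) = T 1 ^ n := by rw [T_pow, mul_one]
    rw [hpow, map_pow, map_pow, hT]
  refine (((isUnit_T (n : ℤ)).map f).mul_left_inj).1 ?_
  have := RingHom.congr_fun hp p
  rw [RingHom.comp_apply, RingHom.comp_apply, hp', map_mul, map_mul, hn] at this
  exact this

/-- Every Laurent polynomial over a field that is not zero becomes invertible in the Laurent
series over an algebra. -/
theorem isUnit_toSeries_laurentMap {k B : Type*} [Field k] [CommRing B] (f : k →+* B)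
    {c : k[T;T⁻¹]} (hc : c ≠ 0) : IsUnit (toSeries B (laurentMap f c)) := by
  obtain ⟨n, p, hp⟩ := LaurentPolynomial.exists_T_pow c
  have hp0 : p ≠ 0 := by
    rintro rfl
    rw [map_zero, eq_comm, (isUnit_T (n : ℤ)).mul_left_eq_zero] at hp
    exact hc hp
  obtain ⟨q, hq, hndvd⟩ := Polynomial.exists_eq_pow_rootMultiplicity_mul_and_not_dvd p hp0 0
  rw [Polynomial.C_0, sub_zero] at hq hndvd
  have hunit : ∀ x : B[T;T⁻¹], IsUnit x → IsUnit (toSeries B x) := fun x hx => hx.map _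
  have hX : IsUnit
      (toSeries B (laurentMap f (toLaurent (Polynomial.X ^ p.rootMultiplicity 0)))) := by
    rw [map_pow, toLaurent_X]
    exact (((isUnit_T 1).pow _).map _).map _
  have hq0 : IsUnit (toSeries B (laurentMap f (toLaurent q))) := by
    rw [← RingHom.comp_apply (laurentMap f), laurentMap_toLaurent, RingHom.comp_apply,
      toSeries_toLaurent]
    refine IsUnit.map _ (PowerSeries.isUnit_iff_constantCoeff.2 ?_)
    rw [Polynomial.constantCoeff_coe, coe_mapRingHom, Polynomial.coeff_map]
    refine IsUnit.map _ (isUnit_iff_ne_zero.2 fun h => hndvd ?_)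
    exact Polynomial.X_dvd_iff.2 h
  have hprod := hX.mul hq0
  rw [← map_mul, ← map_mul, ← map_mul, ← hq, hp, map_mul, map_mul] at hprod
  exact isUnit_of_mul_isUnit_left hprod

variable {k G : Type*} [Field k] [AddCommGroup G]

/-- The map from `k[G][T;T⁻¹]` to the group algebra of `G` over the fraction field of `k[T;T⁻¹]`. -/
noncomputable def toFracCoeff (k G : Type*) [Field k] [AddCommGroup G] :
    (AddMonoidAlgebra k G)[T;T⁻¹] →+* AddMonoidAlgebra (FractionRing k[T;T⁻¹]) G :=
  LaurentPolynomial.eval₂ (AddMonoidAlgebra.mapRingHom G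
    ((algebraMap k[T;T⁻¹] (FractionRing k[T;T⁻¹])).comp LaurentPolynomial.C))
    (Units.map (AddMonoidAlgebra.singleZeroRingHom.comp
      (algebraMap k[T;T⁻¹] (FractionRing k[T;T⁻¹]))).toMonoidHom (laurentUnit k))

theorem toFracCoeff_C_single (g : G) (a : k) :
    toFracCoeff k G (LaurentPolynomial.C (AddMonoidAlgebra.single g a)) =
      AddMonoidAlgebra.single g (algebraMap k[T;T⁻¹] _ (LaurentPolynomial.C a)) := by
  rw [toFracCoeff, LaurentPolynomial.eval₂_C, AddMonoidAlgebra.mapRingHom_single]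
  rfl

theorem toFracCoeff_T :
    toFracCoeff k G (T 1) = AddMonoidAlgebra.single 0 (algebraMap k[T;T⁻¹] _ (T 1)) := by
  rw [toFracCoeff, LaurentPolynomial.eval₂_T, zpow_one, ← coe_laurentUnit_zpow, zpow_one]
  rfl

/-- The inclusion of the Laurent polynomials with coefficients in `k`. -/
noncomputable abbrev laurentConst (k G : Type*) [Field k] [AddCommGroup G] :
    k[T;T⁻¹] →+* (AddMonoidAlgebra k G)[T;T⁻¹] :=
  laurentMap AddMonoidAlgebra.singleZeroRingHom

theorem laurentMap_C {A B : Type*} [CommRing A] [CommRing B] (f : B →+* A) (b : B) :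
    laurentMap f (LaurentPolynomial.C b) = LaurentPolynomial.C (f b) := by
  rw [laurentMap, LaurentPolynomial.eval₂_C, RingHom.comp_apply]

theorem laurentMap_T {A B : Type*} [CommRing A] [CommRing B] (f : B →+* A) (n : ℤ) :
    laurentMap f (T n) = T n := by
  rw [laurentMap, LaurentPolynomial.eval₂_T, coe_laurentUnit_zpow]

theorem toFracCoeff_laurentConst (c : k[T;T⁻¹]) :
    toFracCoeff k G (laurentConst k G c) = AddMonoidAlgebra.single 0 (algebraMap _ _ c) := by
  have : (toFracCoeff k G).comp (laurentConst k G) =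
      AddMonoidAlgebra.singleZeroRingHom.comp (algebraMap k[T;T⁻¹] (FractionRing k[T;T⁻¹])) := by
    refine laurent_ringHom_ext (fun a => ?_) ?_
    · rw [RingHom.comp_apply, laurentMap_C]
      exact toFracCoeff_C_single 0 a
    · rw [RingHom.comp_apply, laurentMap_T, toFracCoeff_T]
      rfl
  exact RingHom.congr_fun this c

/-- A ring homomorphism from `k[G][T;T⁻¹]` that inverts the elements of `k[T;T⁻¹]` other than zero
extends to the group algebra over the fraction field. -/
theorem exists_comp_toFracCoeff_eq {S : Type*} [CommRing S]
    (f : (AddMonoidAlgebra k G)[T;T⁻¹] →+* S)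
    (hf : ∀ c : k[T;T⁻¹], c ≠ 0 → IsUnit (f (laurentConst k G c))) :
    ∃ f' : AddMonoidAlgebra (FractionRing k[T;T⁻¹]) G →+* S, f'.comp (toFracCoeff k G) = f := by
  let φ : FractionRing k[T;T⁻¹] →+* S := IsLocalization.lift (M := nonZeroDivisors k[T;T⁻¹])
    (g := f.comp (laurentConst k G)) fun y => hf y (nonZeroDivisors.coe_ne_zero y)
  have hφ : ∀ c, φ (algebraMap _ _ c) = f (laurentConst k G c) :=
    fun c => IsLocalization.lift_eq _ c
  let χ : Multiplicative G →* S :=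
    ((f.comp LaurentPolynomial.C : AddMonoidAlgebra k G →+* S) : AddMonoidAlgebra k G →* S).comp
      (AddMonoidAlgebra.of k G)
  refine ⟨AddMonoidAlgebra.liftNCRingHom φ χ fun _ _ => Commute.all _ _, ?_⟩
  have hs : ∀ g a, AddMonoidAlgebra.liftNCRingHom φ χ (fun _ _ => Commute.all _ _)
      (AddMonoidAlgebra.single g a) = φ a * f (LaurentPolynomial.C (AddMonoidAlgebra.single g 1)) :=
    fun g a => AddMonoidAlgebra.liftNC_single _ _ _ _
  refine laurent_ringHom_ext (fun a => ?_) ?_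
  · rw [RingHom.comp_apply]
    induction a using AddMonoidAlgebra.induction_linear with
    | zero => simp only [map_zero]
    | add a b ha hb => simp only [map_add, ha, hb]
    | single g a =>
      have hga : AddMonoidAlgebra.singleZeroRingHom a * AddMonoidAlgebra.single g 1 =
          AddMonoidAlgebra.single g a :=
        (AddMonoidAlgebra.single_mul_single _ _ _ _).trans (by rw [zero_add, mul_one])
      rw [toFracCoeff_C_single, hs, hφ, laurentMap_C, ← map_mul, ← map_mul, hga]
  · rw [RingHom.comp_apply, toFracCoeff_T, hs, hφ, laurentMap_T,
      ← AddMonoidAlgebra.one_def, map_one, map_one, mul_one]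

theorem exists_mul_eq_toFracCoeff (x : AddMonoidAlgebra (FractionRing k[T;T⁻¹]) G) :
    ∃ c : k[T;T⁻¹], c ≠ 0 ∧ ∃ y, toFracCoeff k G (laurentConst k G c) * x = toFracCoeff k G y := by
  induction x using AddMonoidAlgebra.induction_linear with
  | zero => exact ⟨1, one_ne_zero, 0, by rw [mul_zero, map_zero]⟩
  | add x y hx hy =>
    obtain ⟨c, hc, x', hx'⟩ := hx
    obtain ⟨d, hd, y', hy'⟩ := hy
    refine ⟨c * d, mul_ne_zero hc hd, laurentConst k G d * x' + laurentConst k G c * y', ?_⟩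
    simp only [map_add, map_mul, ← hx', ← hy']
    ring
  | single g a =>
    obtain ⟨⟨b, c⟩, hbc⟩ := IsLocalization.surj (nonZeroDivisors k[T;T⁻¹]) a
    refine ⟨c, nonZeroDivisors.coe_ne_zero c, laurentConst k G b *
      LaurentPolynomial.C (AddMonoidAlgebra.single g 1), ?_⟩
    rw [map_mul, toFracCoeff_laurentConst, toFracCoeff_laurentConst, toFracCoeff_C_single,
      AddMonoidAlgebra.single_mul_single, AddMonoidAlgebra.single_mul_single, map_one, map_one,
      mul_one, ← hbc, mul_comm]

theorem injective_of_comp_toFracCoeff {S : Type*} [CommRing S]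
    {f : AddMonoidAlgebra (FractionRing k[T;T⁻¹]) G →+* S}
    (hf : Function.Injective (f.comp (toFracCoeff k G))) : Function.Injective f := by
  refine (injective_iff_map_eq_zero f).2 fun x hx => ?_
  obtain ⟨c, hc, y, hy⟩ := exists_mul_eq_toFracCoeff x
  have hy0 : y = 0 := by
    refine (injective_iff_map_eq_zero _).1 hf y ?_
    rw [RingHom.comp_apply, ← hy, map_mul, hx, mul_zero]
  rw [hy0, map_zero, toFracCoeff_laurentConst] at hy
  have hu : IsUnit (AddMonoidAlgebra.singleZeroRingHom (M := G)
      (algebraMap k[T;T⁻¹] (FractionRing k[T;T⁻¹]) c)) := by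
    refine IsUnit.map _ (isUnit_iff_ne_zero.2 ?_)
    exact (map_ne_zero_iff _ (IsFractionRing.injective _ _)).2 hc
  exact hu.mul_right_eq_zero.1 hy

end FractionCoefficients

section FieldOfFractions

open LaurentPolynomial

variable {m : ℕ}

theorem mem_of_leftInverse {R S : Type*} [CommRing R] [CommRing S] {f : R →+* S} {f' : S →+* R}
    (hf : f'.comp f = RingHom.id R) {g : SpecialLinearGroup (Fin m) R}
    (hg : SpecialLinearGroup.map f g ∈ ElemSubgroup m S) : g ∈ ElemSubgroup m R := by
  have := map_mem f' hg
  rwa [map_map, hf, map_id] at this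

/-- The map interchanging the adjunction of polynomial variables and of a Laurent variable. -/
noncomputable def mvLaurentSwap (σ A : Type*) [CommRing A] :
    MvPolynomial σ A[T;T⁻¹] →+* (MvPolynomial σ A)[T;T⁻¹] :=
  MvPolynomial.eval₂Hom (laurentMap MvPolynomial.C) fun i => LaurentPolynomial.C (MvPolynomial.X i)

/-- The inverse of `mvLaurentSwap`. -/
noncomputable def laurentMvSwap (σ A : Type*) [CommRing A] :
    (MvPolynomial σ A)[T;T⁻¹] →+* MvPolynomial σ A[T;T⁻¹] :=
  LaurentPolynomial.eval₂ (MvPolynomial.map LaurentPolynomial.C)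
    (Units.map (MvPolynomial.C (σ := σ)).toMonoidHom (laurentUnit A))

theorem laurentMvSwap_comp_mvLaurentSwap (σ A : Type*) [CommRing A] :
    (laurentMvSwap σ A).comp (mvLaurentSwap σ A) = RingHom.id _ := by
  have hC : ((laurentMvSwap σ A).comp (mvLaurentSwap σ A)).comp MvPolynomial.C =
      MvPolynomial.C := by
    refine laurent_ringHom_ext (fun a => ?_) ?_
    · simp only [RingHom.comp_apply, mvLaurentSwap, MvPolynomial.coe_eval₂Hom,
        MvPolynomial.eval₂_C, laurentMap_C, laurentMvSwap, LaurentPolynomial.eval₂_C,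
        MvPolynomial.map_C]
    · simp only [RingHom.comp_apply, mvLaurentSwap, MvPolynomial.coe_eval₂Hom,
        MvPolynomial.eval₂_C, laurentMap_T, laurentMvSwap, LaurentPolynomial.eval₂_T, zpow_one]
      rw [← coe_laurentUnit_zpow, zpow_one]
      rfl
  refine MvPolynomial.ringHom_ext (fun a => RingHom.congr_fun hC a) fun i => ?_
  simp only [RingHom.comp_apply, mvLaurentSwap, MvPolynomial.coe_eval₂Hom,
    MvPolynomial.eval₂_X, laurentMvSwap, LaurentPolynomial.eval₂_C, MvPolynomial.map_X,
    RingHom.id_apply]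

theorem laurentMap_comp {A B D : Type*} [CommRing A] [CommRing B] [CommRing D] (f : A →+* B)
    (f' : B →+* D) : (laurentMap f').comp (laurentMap f) = laurentMap (f'.comp f) := by
  refine laurent_ringHom_ext (fun a => ?_) ?_
  · simp only [RingHom.comp_apply, laurentMap_C]
  · simp only [RingHom.comp_apply, laurentMap_T]

theorem invertHom_comp_laurentMap {A B : Type*} [CommRing A] [CommRing B] (f : A →+* B) :
    (invertHom B).comp (laurentMap f) = (laurentMap f).comp (invertHom A) := by
  refine laurent_ringHom_ext (fun a => ?_) ?_
  · rw [RingHom.comp_apply, RingHom.comp_apply, laurentMap_C]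
    exact (invert_C _).trans ((laurentMap_C f a).symm.trans (congrArg _ (invert_C a).symm))
  · rw [RingHom.comp_apply, RingHom.comp_apply, laurentMap_T]
    exact (invert_T _).trans ((laurentMap_T f _).symm.trans (congrArg _ (invert_T 1).symm))

variable {k G σ : Type*} [Field k] [AddCommGroup G]

theorem map_mvLaurentSwap_mem {S : Type*} [CommRing S]
    (f : (MvPolynomial σ (AddMonoidAlgebra k G))[T;T⁻¹] →+* S)
    (hf : ∀ c : k[T;T⁻¹], c ≠ 0 → IsUnit (f (laurentMap
      (MvPolynomial.C.comp AddMonoidAlgebra.singleZeroRingHom) c)))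
    {g : SpecialLinearGroup (Fin m) (MvPolynomial σ (AddMonoidAlgebra k G)[T;T⁻¹])}
    (hg : SpecialLinearGroup.map (MvPolynomial.map (toFracCoeff k G)) g ∈ ElemSubgroup m
      (MvPolynomial σ (AddMonoidAlgebra (FractionRing k[T;T⁻¹]) G))) :
    SpecialLinearGroup.map f (SpecialLinearGroup.map (mvLaurentSwap σ _) g) ∈ ElemSubgroup m S := by
  obtain ⟨φ, hφ⟩ := exists_comp_toFracCoeff_eq (k := k) (G := G)
    (f.comp (laurentMap MvPolynomial.C)) fun c hc => by
      rw [RingHom.comp_apply, ← RingHom.comp_apply (laurentMap _), laurentMap_comp]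
      exact hf c hc
  have hcomp : (MvPolynomial.eval₂Hom φ fun i => f (LaurentPolynomial.C (MvPolynomial.X i))).comp
      (MvPolynomial.map (toFracCoeff k G)) = f.comp (mvLaurentSwap σ _) := by
    refine MvPolynomial.ringHom_ext (fun a => ?_) fun i => ?_
    · have := RingHom.congr_fun hφ a
      simpa [mvLaurentSwap] using this
    · simp [mvLaurentSwap]
  have := map_mem (MvPolynomial.eval₂Hom φ fun i => f (LaurentPolynomial.C (MvPolynomial.X i))) hg
  rw [map_map] at this ⊢
  exact hcomp ▸ this

theorem mem_of_map_toFracCoeff_mem [IsDomain (AddMonoidAlgebra k G)] (hm : 3 ≤ m)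
    {g : SpecialLinearGroup (Fin m) (MvPolynomial σ (AddMonoidAlgebra k G)[T;T⁻¹])}
    (hg : SpecialLinearGroup.map (MvPolynomial.map (toFracCoeff k G)) g ∈ ElemSubgroup m
      (MvPolynomial σ (AddMonoidAlgebra (FractionRing k[T;T⁻¹]) G))) :
    g ∈ ElemSubgroup m _ := by
  refine mem_of_leftInverse (laurentMvSwap_comp_mvLaurentSwap σ _) ?_
  refine mem_of_toSeries_mem hm (map_mvLaurentSwap_mem _ (fun c hc => ?_) hg)
    (map_mvLaurentSwap_mem _ (fun c hc => ?_) hg)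
  · exact isUnit_toSeries_laurentMap _ hc
  · rw [RingHom.comp_apply, ← RingHom.comp_apply (invertHom _), invertHom_comp_laurentMap,
      RingHom.comp_apply]
    refine isUnit_toSeries_laurentMap _ fun h => hc ?_
    rw [← RingHom.id_apply c, ← invertHom_comp_invertHom, RingHom.comp_apply, h, map_zero]

theorem mem_of_map_injective_of_subsingleton [Subsingleton G] {K : Type*} [Field K]
    (ψ : AddMonoidAlgebra k G →+* K) (hψ : Function.Injective ψ)
    (hfrac : ∀ x, ∃ a b, x = ψ a / ψ b)
    {g : SpecialLinearGroup (Fin m) (MvPolynomial σ (AddMonoidAlgebra k G))}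
    (hg : SpecialLinearGroup.map (MvPolynomial.map ψ) g ∈ ElemSubgroup m (MvPolynomial σ K)) :
    g ∈ ElemSubgroup m _ := by
  have hinv : ∀ b, ∃ c, ψ c = (ψ b)⁻¹ := by
    intro b
    have hb : b = AddMonoidAlgebra.singleZeroRingHom (b.coeff 0) := by
      ext x
      rw [Subsingleton.elim x 0]
      simp
    rw [hb]
    exact ⟨_, map_inv₀ (ψ.comp AddMonoidAlgebra.singleZeroRingHom) _⟩
  have hsurj : Function.Surjective ψ := by
    intro x
    obtain ⟨a, b, rfl⟩ := hfrac x
    obtain ⟨c, hc⟩ := hinv b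
    exact ⟨a * c, by rw [map_mul, hc, div_eq_mul_inv]⟩
  let e := RingEquiv.ofBijective ψ ⟨hψ, hsurj⟩
  refine mem_of_leftInverse (f' := MvPolynomial.map (e.symm : K →+* _)) ?_ hg
  refine MvPolynomial.ringHom_ext (fun a => ?_) fun i => ?_
  · simp only [RingHom.comp_apply, MvPolynomial.map_C, RingHom.id_apply]
    exact congrArg _ (e.symm_apply_apply a)
  · simp

/-- Splitting off the first coordinate of a finitely supported integer vector. -/
noncomputable def consAddEquiv (n : ℕ) : (Fin (n + 1) →₀ ℤ) ≃+ ℤ × (Fin n →₀ ℤ) where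
  toFun v := (v 0, v.tail)
  invFun w := Finsupp.cons w.1 w.2
  left_inv v := Finsupp.cons_tail v
  right_inv w := by simp
  map_add' v w := by
    refine Prod.ext rfl ?_
    ext i
    simp [Finsupp.tail_apply]

/-- Splitting off the first variable of a Laurent polynomial ring. -/
noncomputable def laurentConsEquiv (k : Type*) [Field k] (n : ℕ) :
    AddMonoidAlgebra k (Fin (n + 1) →₀ ℤ) ≃+* (AddMonoidAlgebra k (Fin n →₀ ℤ))[T;T⁻¹] :=
  (AddMonoidAlgebra.mapDomainRingEquiv k (consAddEquiv n)).trans AddMonoidAlgebra.curryRingEquiv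

universe u v

theorem mem_of_map_injective (hm : 3 ≤ m) {K : Type v} [Field K] (n : ℕ) :
    ∀ (k : Type u) [Field k] (ψ : AddMonoidAlgebra k (Fin n →₀ ℤ) →+* K),
      Function.Injective ψ → (∀ x, ∃ a b, x = ψ a / ψ b) →
      ∀ g : SpecialLinearGroup (Fin m) (MvPolynomial σ (AddMonoidAlgebra k (Fin n →₀ ℤ))),
        SpecialLinearGroup.map (MvPolynomial.map ψ) g ∈ ElemSubgroup m (MvPolynomial σ K) →
        g ∈ ElemSubgroup m _ := by
  induction n with
  | zero =>
    intro k _ ψ hψ hfrac g hg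
    exact mem_of_map_injective_of_subsingleton ψ hψ hfrac hg
  | succ n ih =>
    intro k _ ψ hψ hfrac g hg
    let e := laurentConsEquiv k n
    let f : (AddMonoidAlgebra k (Fin n →₀ ℤ))[T;T⁻¹] →+* K := ψ.comp e.symm.toRingHom
    have hf : Function.Injective f := hψ.comp e.symm.injective
    have hfe : ∀ a, f (e a) = ψ a := fun a => congrArg ψ (e.symm_apply_apply a)
    obtain ⟨φ, hφ⟩ := exists_comp_toFracCoeff_eq f fun c hc => by
      refine isUnit_iff_ne_zero.2 ((map_ne_zero_iff f hf).2 fun h => ?_)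
      have hu := isUnit_toSeries_laurentMap
        (AddMonoidAlgebra.singleZeroRingHom : k →+* AddMonoidAlgebra k (Fin n →₀ ℤ)) hc
      exact hu.ne_zero ((congrArg _ h).trans (map_zero _))
    have hφe : ∀ a, φ (toFracCoeff k _ (e a)) = ψ a := fun a =>
      (RingHom.congr_fun hφ _).trans (hfe a)
    have hE : (MvPolynomial.map e.symm.toRingHom).comp (MvPolynomial.map e.toRingHom) =
        RingHom.id (MvPolynomial σ (AddMonoidAlgebra k (Fin (n + 1) →₀ ℤ))) := by
      refine MvPolynomial.ringHom_ext (fun a => ?_) fun i => ?_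
      · simp
      · simp
    refine mem_of_leftInverse hE (mem_of_map_toFracCoeff_mem (k := k) (G := Fin n →₀ ℤ) hm ?_)
    refine ih _ φ (injective_of_comp_toFracCoeff (hφ ▸ hf)) (fun x => ?_) _ ?_
    · obtain ⟨a, b, rfl⟩ := hfrac x
      exact ⟨toFracCoeff k _ (e a), toFracCoeff k _ (e b), by rw [hφe, hφe]⟩
    · convert hg using 1
      rw [map_map, map_map]
      congr 2
      refine MvPolynomial.ringHom_ext (fun a => ?_) fun i => ?_
      · simpa using congrArg (MvPolynomial.C (σ := σ)) (hφe a)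
      · simp

end FieldOfFractions

section RationalFunctions

variable {k : Type*} [Field k] {n : ℕ}

/-- The inclusion of polynomials in Laurent polynomials. -/
noncomputable def polyToLaurent (k : Type*) [Field k] (n : ℕ) :
    MvPolynomial (Fin n) k →+* AddMonoidAlgebra k (Fin n →₀ ℤ) :=
  MvPolynomial.eval₂Hom AddMonoidAlgebra.singleZeroRingHom
    fun i => AddMonoidAlgebra.single (Finsupp.single i 1) 1

theorem polyToLaurent_C (a : k) :
    polyToLaurent k n (MvPolynomial.C a) = AddMonoidAlgebra.single 0 a :=
  MvPolynomial.eval₂_C _ _ _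

theorem polyToLaurent_X_pow (i : Fin n) (r : ℕ) :
    polyToLaurent k n (MvPolynomial.X i ^ r) =
      AddMonoidAlgebra.single (Finsupp.single i (r : ℤ)) 1 := by
  rw [polyToLaurent, map_pow, MvPolynomial.coe_eval₂Hom, MvPolynomial.eval₂_X,
    AddMonoidAlgebra.single_pow, one_pow, Finsupp.smul_single, nsmul_eq_mul, mul_one]

theorem single_mul_single_neg (v : Fin n →₀ ℤ) :
    AddMonoidAlgebra.single v (1 : k) * AddMonoidAlgebra.single (-v) 1 = 1 := by
  rw [AddMonoidAlgebra.single_mul_single, add_neg_cancel, one_mul, AddMonoidAlgebra.one_def]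

theorem exists_isUnit_mul_single_eq_polyToLaurent (v : Fin n →₀ ℤ) :
    ∃ q, IsUnit (polyToLaurent k n q) ∧
      ∃ r, polyToLaurent k n q * AddMonoidAlgebra.single v 1 = polyToLaurent k n r := by
  induction v using Finsupp.induction_linear with
  | zero => exact ⟨1, by simp, 1, by rw [map_one, one_mul, AddMonoidAlgebra.one_def]⟩
  | add v w hv hw =>
    obtain ⟨q, hq, r, hr⟩ := hv
    obtain ⟨q', hq', r', hr'⟩ := hw
    refine ⟨q * q', by rw [map_mul]; exact hq.mul hq', r * r', ?_⟩
    have : AddMonoidAlgebra.single (v + w) (1 : k) =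
        AddMonoidAlgebra.single v 1 * AddMonoidAlgebra.single w 1 := by
      rw [AddMonoidAlgebra.single_mul_single, one_mul]
    rw [map_mul, map_mul, this, ← hr, ← hr']
    ring
  | single i z =>
    obtain ⟨l, rfl | rfl⟩ := z.eq_nat_or_neg
    · exact ⟨1, by simp, MvPolynomial.X i ^ l, by rw [map_one, one_mul, polyToLaurent_X_pow]⟩
    · refine ⟨MvPolynomial.X i ^ l, ?_, 1, ?_⟩
      · rw [polyToLaurent_X_pow]
        exact IsUnit.of_mul_eq_one _ (single_mul_single_neg _)
      · rw [polyToLaurent_X_pow, map_one, Finsupp.single_neg, single_mul_single_neg]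

theorem exists_isUnit_mul_eq_polyToLaurent (f : AddMonoidAlgebra k (Fin n →₀ ℤ)) :
    ∃ q, IsUnit (polyToLaurent k n q) ∧
      ∃ r, polyToLaurent k n q * f = polyToLaurent k n r := by
  induction f using AddMonoidAlgebra.induction_linear with
  | zero => exact ⟨1, by simp, 0, by rw [mul_zero, map_zero]⟩
  | add x y hx hy =>
    obtain ⟨q, hq, r, hr⟩ := hx
    obtain ⟨q', hq', r', hr'⟩ := hy
    refine ⟨q * q', by rw [map_mul]; exact hq.mul hq', r * q' + q * r', ?_⟩
    simp only [map_mul, map_add, ← hr, ← hr']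
    ring
  | single v a =>
    obtain ⟨q, hq, r, hr⟩ := exists_isUnit_mul_single_eq_polyToLaurent (k := k) v
    refine ⟨q, hq, r * MvPolynomial.C a, ?_⟩
    rw [map_mul, ← hr, polyToLaurent_C, mul_assoc, AddMonoidAlgebra.single_mul_single, add_zero,
      one_mul]

end RationalFunctions

end ElemSubgroup

/-- Lemma 4.4, first claim, for `SL_m` (`m ≥ 3`), over a field `k` of characteristic 0:
the natural map `SL_m(k[x₁^{±1},…,xₙ^{±1}][y₁,…,y_p]) → SL_m(k(x₁,…,xₙ)[y₁,…,y_p])`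
pulls elementary matrices back to elementary matrices; in particular (`p = 0`)
`K1^{SL_m}(k[x₁^{±1},…,xₙ^{±1}]) → K1^{SL_m}(k(x₁,…,xₙ))` is injective. -/
theorem k1_laurentPoly_poly_to_ratFunc_injective
    (k : Type*) [Field k] [CharZero k]
    (m : ℕ) (hm : 3 ≤ m) (n p : ℕ)
    -- `Kx` is (a model of) the rational function field `k(x₁,…,xₙ)`
    (Kx : Type*) [Field Kx] [Algebra (MvPolynomial (Fin n) k) Kx]
    [IsFractionRing (MvPolynomial (Fin n) k) Kx]
    -- `ψ : k[x₁^{±1},…,xₙ^{±1}] → k(x₁,…,xₙ)` is the canonical inclusion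
    (ψ : AddMonoidAlgebra k (Fin n →₀ ℤ) →+* Kx)
    (hψC : ∀ a : k, ψ (AddMonoidAlgebra.single 0 a)
        = algebraMap (MvPolynomial (Fin n) k) Kx (MvPolynomial.C a))
    (hψX : ∀ i : Fin n,
      ψ (AddMonoidAlgebra.single (Finsupp.single i (1 : ℤ)) (1 : k))
        = algebraMap (MvPolynomial (Fin n) k) Kx (MvPolynomial.X i))
    (g : SpecialLinearGroup (Fin m) (MvPolynomial (Fin p) (AddMonoidAlgebra k (Fin n →₀ ℤ))))
    (h : SpecialLinearGroup.map (MvPolynomial.map ψ) g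
        ∈ ElemSubgroup m (MvPolynomial (Fin p) Kx)) :
    g ∈ ElemSubgroup m (MvPolynomial (Fin p) (AddMonoidAlgebra k (Fin n →₀ ℤ))) := by
  have hψ : ψ.comp (ElemSubgroup.polyToLaurent k n) = algebraMap (MvPolynomial (Fin n) k) Kx := by
    refine MvPolynomial.ringHom_ext (fun a => ?_) fun i => ?_
    · rw [RingHom.comp_apply, ElemSubgroup.polyToLaurent_C, hψC]
    · rw [RingHom.comp_apply, ← pow_one (MvPolynomial.X i), ElemSubgroup.polyToLaurent_X_pow,
        Nat.cast_one, hψX, pow_one]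
  refine ElemSubgroup.mem_of_map_injective hm n k ψ ?_ (fun x => ?_) g h
  · refine (injective_iff_map_eq_zero ψ).2 fun f hf => ?_
    obtain ⟨q, hq, r, hr⟩ := ElemSubgroup.exists_isUnit_mul_eq_polyToLaurent f
    have hr0 : r = 0 := by
      refine (injective_iff_map_eq_zero _).1 (IsFractionRing.injective _ Kx) r ?_
      rw [← hψ, RingHom.comp_apply, ← hr, map_mul, hf, mul_zero]
    rw [hr0, map_zero] at hr
    exact hq.mul_right_eq_zero.1 hr
  · obtain ⟨a, b, -, rfl⟩ := IsFractionRing.div_surjective (A := MvPolynomial (Fin n) k) x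
    exact ⟨_, _, by rw [← hψ, RingHom.comp_apply, RingHom.comp_apply]⟩
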